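/- arXiv:math/0012120 — 10 statements merged into one kernel-verified Lean document; each statement's English description precedes it below -/
import Mathlib

section
/- Let V_1,…,V_p and W_1,…,W_q be finite-dimensional complex vector spaces with Σ_i dim V_i = Σ_j dim W_j, let m_{ij} : V_i → W_j be linear maps whose total map M : ⊕_i V_i → ⊕_j W_j is bijective, and let X_i : V_i → V_i and Y_j : W_j → W_j be linear endomorphisms. If the total map of the family (Y_j ∘ m_{ij} ∘ X_i)_{ij} is not bijective, then this degenerated representation is not θ-semistable: there exist subspaces V'_i ⊆ V_i and W'_j ⊆ W_j with (Y_j ∘ m_{ij} ∘ X_i)(V'_i) ⊆ W'_j for all i,j and Σ_j dim W'_j < Σ_i dim V'_i. -/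
/-- If the total map of a bipartite-quiver representation is bijective but the total map of
the degenerated representation `(Y_j ∘ m_{ij} ∘ X_i)` is not bijective, then the degenerated
representation is not θ-semistable: it admits a subrepresentation with
`Σ dim W'_j < Σ dim V'_i`. -/
theorem degeneration_of_invertible_not_semistable
    (p q : ℕ)
    (V : Fin p → Type) (W : Fin q → Type)
    [∀ i, AddCommGroup (V i)] [∀ i, Module ℂ (V i)] [∀ i, FiniteDimensional ℂ (V i)]
    [∀ j, AddCommGroup (W j)] [∀ j, Module ℂ (W j)] [∀ j, FiniteDimensional ℂ (W j)]
    (hdim : ∑ i, Module.finrank ℂ (V i) = ∑ j, Module.finrank ℂ (W j))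
    (m : ∀ i j, V i →ₗ[ℂ] W j)
    (X : ∀ i, V i →ₗ[ℂ] V i) (Y : ∀ j, W j →ₗ[ℂ] W j)
    (hM : Function.Bijective
      (LinearMap.pi (fun j => ∑ i, (m i j).comp (LinearMap.proj i)) :
        (∀ i, V i) →ₗ[ℂ] (∀ j, W j)))
    (hXMY : ¬ Function.Bijective
      (LinearMap.pi (fun j => ∑ i, ((Y j).comp ((m i j).comp (X i))).comp (LinearMap.proj i)) :
        (∀ i, V i) →ₗ[ℂ] (∀ j, W j))) :
    ∃ (V' : ∀ i, Submodule ℂ (V i)) (W' : ∀ j, Submodule ℂ (W j)),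
      (∀ i j, (V' i).map ((Y j).comp ((m i j).comp (X i))) ≤ W' j) ∧
      ∑ j, Module.finrank ℂ (W' j) < ∑ i, Module.finrank ℂ (V' i) := by
  by_cases hX : ∀ i, LinearMap.ker (X i) = ⊥
  · by_cases hY : ∀ j, LinearMap.range (Y j) = ⊤
    · refine absurd ?_ hXMY
      have hXb : Function.Bijective (Pi.map fun i => X i) :=
        Function.Bijective.piMap fun i =>
          have h := LinearMap.ker_eq_bot.mp (hX i)
          ⟨h, LinearMap.injective_iff_surjective.mp h⟩
      have hYb : Function.Bijective (Pi.map fun j => Y j) :=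
        Function.Bijective.piMap fun j =>
          have h := LinearMap.range_eq_top.mp (hY j)
          ⟨LinearMap.injective_iff_surjective.mpr h, h⟩
      convert hYb.comp (hM.comp hXb) using 1
      ext v j
      simp [Pi.map]
    · push Not at hY
      obtain ⟨j, hj⟩ := hY
      refine ⟨fun _ => ⊤, fun j => LinearMap.range (Y j), fun i j => ?_, ?_⟩
      · rintro _ ⟨v, -, rfl⟩
        exact ⟨m i j (X i v), rfl⟩
      · simp only [finrank_top, hdim]
        exact Finset.sum_lt_sum (fun j _ => Submodule.finrank_le _)
          ⟨j, Finset.mem_univ j, Submodule.finrank_lt hj⟩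
  · push Not at hX
    obtain ⟨i, hi⟩ := hX
    refine ⟨fun i => LinearMap.ker (X i), fun _ => ⊥, fun i j => ?_, ?_⟩
    · rintro _ ⟨v, hv, rfl⟩
      have hv : X i v = 0 := hv
      simp [hv]
    · simp only [finrank_bot, Finset.sum_const_zero]
      exact Finset.sum_pos' (fun _ _ => Nat.zero_le _)
        ⟨i, Finset.mem_univ i, Submodule.one_le_finrank_iff.mpr hi⟩
end

section
/- Let m_{ij} : ℂ^{a_i} → ℂ^{b_j} (1≤i≤p, 1≤j≤q) be a θ-semistable representation of the bipartite quiver Q_{p,q}, where Σ_i a_i = Σ_j b_j = n ≥ 1. Then there exist a positive integer N and scalars s_{kl} ∈ ℂ (1≤k≤Np, 1≤l≤Nq) such that the square matrix of size Nn built from blocks, whose (k,l)-block of size a_{((k−1) mod p)+1} × b_{((l−1) mod q)+1} is the scalar multiple s_{kl} · m_{((k−1) mod p)+1, ((l−1) mod q)+1}, is invertible. (Its determinant is a matrix semi-invariant that does not vanish at the given representation.) -/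
namespace Matrix

section Minors

variable {K : Type*} [Field K] {m n : Type*} [Fintype n]

/-- The columns of a matrix over a field contain a basis of the column space. -/
theorem exists_submatrix_id_rank_eq [Finite m] (M : Matrix m n K) {r : ℕ} (hr : M.rank = r) :
    ∃ g : Fin r → n, (M.submatrix id g).rank = r := by
  subst hr
  have key := Submodule.exists_fun_fin_finrank_span_eq K (Set.range M.col)
  rw [← M.rank_eq_finrank_span_cols] at key
  obtain ⟨f, hf, hspan, -⟩ := key
  choose g hg using hf
  refine ⟨g, ?_⟩
  have hcol : (M.submatrix id g).col = f := funext hg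
  rw [rank_eq_finrank_span_cols, hcol, hspan, ← rank_eq_finrank_span_cols]

/-- A matrix over a field has a nonvanishing minor of size its rank. -/
theorem exists_submatrix_det_ne_zero [Fintype m] (M : Matrix m n K) :
    ∃ (f : Fin M.rank → m) (g : Fin M.rank → n), (M.submatrix f g).det ≠ 0 := by
  obtain ⟨g, hg⟩ := M.exists_submatrix_id_rank_eq rfl
  obtain ⟨f, hf⟩ := (M.submatrix id g)ᵀ.exists_submatrix_id_rank_eq ((rank_transpose _).trans hg)
  refine ⟨f, g, ?_⟩
  have h : (M.submatrix f g).rank = M.rank := by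
    rw [← rank_transpose]
    exact hf
  have hli : LinearIndependent K (M.submatrix f g).col := by
    rw [linearIndependent_iff_card_eq_finrank_span, Set.finrank, ← rank_eq_finrank_span_cols, h,
      Fintype.card_fin]
  rw [← isUnit_iff_ne_zero, ← isUnit_iff_isUnit_det]
  exact linearIndependent_cols_iff_isUnit.1 hli

theorem le_rank_of_submatrix_det_ne_zero (M : Matrix m n K) {r : ℕ} (f : Fin r → m) (g : Fin r → n)
    (h : (M.submatrix f g).det ≠ 0) : r ≤ M.rank := by
  have := rank_of_det_ne_zero h
  rw [Fintype.card_fin] at this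
  exact this ▸ M.rank_submatrix_le f g

end Minors

section Specialization

variable {R K : Type*} (F : Type*) [CommRing R] [Field F] [Algebra R F]
  [IsFractionRing R F] [Field K] {m n : Type*} [Fintype m] [Fintype n]

/-- Specialization does not increase the rank. -/
theorem rank_map_le_rank_map_algebraMap (X : Matrix m n R) (e : R →+* K) :
    (X.map e).rank ≤ (X.map (algebraMap R F)).rank := by
  obtain ⟨f, g, h⟩ := (X.map e).exists_submatrix_det_ne_zero
  refine le_rank_of_submatrix_det_ne_zero _ f g ?_
  rw [submatrix_map, ← RingHom.mapMatrix_apply, ← RingHom.map_det] at h ⊢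
  rw [map_ne_zero_iff _ (IsFractionRing.injective R F)]
  exact fun h0 => h (by rw [h0, map_zero])

/-- A sufficiently generic specialization preserves the rank. -/
theorem exists_rank_map_algebraMap_le_rank_map (X : Matrix m n R) :
    ∃ δ : R, δ ≠ 0 ∧ ∀ e : R →+* K, e δ ≠ 0 →
      (X.map (algebraMap R F)).rank ≤ (X.map e).rank := by
  obtain ⟨f, g, h⟩ := (X.map (algebraMap R F)).exists_submatrix_det_ne_zero
  rw [submatrix_map, ← RingHom.mapMatrix_apply, ← RingHom.map_det,
    map_ne_zero_iff _ (IsFractionRing.injective R F)] at h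
  refine ⟨_, h, fun e he => le_rank_of_submatrix_det_ne_zero _ f g ?_⟩
  rwa [submatrix_map, ← RingHom.mapMatrix_apply, ← RingHom.map_det]

end Specialization

end Matrix

section CyclicAlgebra

open Polynomial

section Twist

variable {S : Type*} [CommRing S] (σ : S →+* S) {M : ℕ}

/-- Right multiplication by the generator `v` of a cyclic algebra with `v ^ (M + 1) = X` and
`a * v = v * σ a`, in the coordinates `w ↦ ∑ i, v ^ i * w i`. -/
noncomputable def twistShift (w : Fin (M + 1) → S[X]) : Fin (M + 1) → S[X] :=
  Fin.cons (X * (w (Fin.last M)).map σ) fun i => (w i.castSucc).map σ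

@[simp] theorem twistShift_zero_apply (w : Fin (M + 1) → S[X]) :
    twistShift σ w 0 = X * (w (Fin.last M)).map σ := rfl

@[simp] theorem twistShift_succ_apply (w : Fin (M + 1) → S[X]) (i : Fin M) :
    twistShift σ w i.succ = (w i.castSucc).map σ := rfl

theorem twistShift_zero : twistShift σ (0 : Fin (M + 1) → S[X]) = 0 := by
  funext i
  refine Fin.cases ?_ (fun i => ?_) i <;> simp

theorem twistShift_add (v w : Fin (M + 1) → S[X]) :
    twistShift σ (v + w) = twistShift σ v + twistShift σ w := by
  funext i
  refine Fin.cases ?_ (fun i => ?_) i <;> simp [mul_add]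

theorem twistShift_smul (r : S[X]) (w : Fin (M + 1) → S[X]) :
    twistShift σ (r • w) = r.map σ • twistShift σ w := by
  funext i
  refine Fin.cases ?_ (fun i => ?_) i <;> simp [mul_left_comm]

theorem twistShift_sum {ι : Type*} (s : Finset ι) (w : ι → Fin (M + 1) → S[X]) :
    twistShift σ (∑ k ∈ s, w k) = ∑ k ∈ s, twistShift σ (w k) :=
  map_sum (AddMonoidHom.mk' (twistShift σ) (twistShift_add σ)) w s

theorem iterate_twistShift_zero (k : ℕ) :
    (twistShift σ)^[k] (0 : Fin (M + 1) → S[X]) = 0 :=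
  Function.iterate_fixed (twistShift_zero σ) k

theorem iterate_twistShift_apply (w : Fin (M + 1) → S[X]) (k q : ℕ) (i j : Fin (M + 1))
    (h : (i : ℕ) + (M + 1) * q = k + j) :
    (twistShift σ)^[k] w i = X ^ q * (w j).map (σ ^ k) := by
  induction k generalizing q i with
  | zero =>
    obtain rfl : q = 0 := by
      by_contra hq
      have : M + 1 ≤ (M + 1) * q := Nat.le_mul_of_pos_right _ (Nat.pos_of_ne_zero hq)
      lia
    obtain rfl : i = j := Fin.ext (by lia)
    simp [RingHom.one_def]
  | succ k ih =>
    rw [Function.iterate_succ_apply', pow_succ', RingHom.mul_def, ← Polynomial.map_map]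
    induction i using Fin.cases with
    | zero =>
      obtain ⟨q, rfl⟩ : ∃ q', q = q' + 1 := Nat.exists_eq_succ_of_ne_zero (by
        rintro rfl
        simp only [Fin.val_zero] at h
        lia)
      rw [twistShift_zero_apply, ih q (Fin.last M) (by
        simp only [Fin.val_zero, Fin.val_last] at h ⊢
        lia)]
      simp [pow_succ', mul_assoc]
    | succ i =>
      rw [twistShift_succ_apply, ih q i.castSucc (by
        simp only [Fin.val_succ, Fin.val_castSucc] at h ⊢
        lia)]
      simp

theorem iterate_twistShift_eq_smul (hσ : σ ^ (M + 1) = 1) (w : Fin (M + 1) → S[X]) :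
    (twistShift σ)^[M + 1] w = (X : S[X]) • w := by
  funext i
  rw [iterate_twistShift_apply σ w (M + 1) 1 i i (by lia), hσ]
  simp [RingHom.one_def]

/-- The matrix of left multiplication by `∑ i, v ^ i * w i` in the cyclic algebra. -/
noncomputable def twistMatrix (w : Fin (M + 1) → S[X]) :
    Matrix (Fin (M + 1)) (Fin (M + 1)) S[X] :=
  Matrix.of fun i j => (twistShift σ)^[j] w i

theorem twistMatrix_mulVec (w v : Fin (M + 1) → S[X]) :
    (twistMatrix σ w).mulVec v = ∑ j, v j • (twistShift σ)^[j] w := by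
  funext i
  simp [Matrix.mulVec, dotProduct, twistMatrix, mul_comm]

theorem twistMatrix_mulVec_twistShift (hσ : σ ^ (M + 1) = 1) (w v : Fin (M + 1) → S[X]) :
    (twistMatrix σ w).mulVec (twistShift σ v) = twistShift σ ((twistMatrix σ w).mulVec v) := by
  rw [twistMatrix_mulVec, twistMatrix_mulVec, twistShift_sum, Fin.sum_univ_succ,
    Fin.sum_univ_castSucc (n := M)]
  simp only [twistShift_smul, ← Function.iterate_succ_apply' (twistShift σ), Fin.val_last,
    Fin.val_castSucc, Fin.val_succ, Fin.val_zero, twistShift_zero_apply, twistShift_succ_apply,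
    Function.iterate_zero, id_eq, Nat.succ_eq_add_one, iterate_twistShift_eq_smul σ hσ]
  rw [smul_smul, mul_comm X]
  exact add_comm _ _

/-- The element `∑ i, v ^ i * w i` of the cyclic algebra, as a polynomial in `v`. -/
noncomputable def twistPoly (w : Fin (M + 1) → S[X]) : S[X] :=
  ∑ i, expand S (M + 1) (w i) * X ^ (i : ℕ)

theorem twistPoly_sum_smul {ι : Type*} (s : Finset ι) (r : ι → S[X])
    (w : ι → Fin (M + 1) → S[X]) :
    twistPoly (∑ k ∈ s, r k • w k) = ∑ k ∈ s, expand S (M + 1) (r k) * twistPoly (w k) := by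
  simp only [twistPoly, Finset.sum_apply, Pi.smul_apply, smul_eq_mul, map_sum, map_mul,
    Finset.sum_mul, Finset.mul_sum, mul_assoc]
  exact Finset.sum_comm

theorem twistPoly_twistShift (w : Fin (M + 1) → S[X]) :
    twistPoly (twistShift σ w) = X * (twistPoly w).map σ := by
  rw [twistPoly, twistPoly, Fin.sum_univ_succ, Fin.sum_univ_castSucc (n := M), add_comm]
  simp only [twistShift_zero_apply, twistShift_succ_apply, map_mul, expand_X, Fin.val_zero,
    Fin.val_succ, Fin.val_castSucc, Fin.val_last, pow_zero, mul_one, Polynomial.map_add,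
    Polynomial.map_sum, Polynomial.map_mul, Polynomial.map_pow, map_X, mul_add, Finset.mul_sum,
    map_expand]
  congr 1
  · refine Finset.sum_congr rfl fun i _ => ?_
    ring
  · ring

theorem natDegree_twistPoly_iterate [IsDomain S] (hinj : Function.Injective σ)
    (w : Fin (M + 1) → S[X]) (hw : twistPoly w ≠ 0) (k : ℕ) :
    twistPoly ((twistShift σ)^[k] w) ≠ 0 ∧
      (twistPoly ((twistShift σ)^[k] w)).natDegree = k + (twistPoly w).natDegree := by
  induction k with
  | zero => simpa using hw
  | succ k ih =>
    have h0 : (twistPoly ((twistShift σ)^[k] w)).map σ ≠ 0 :=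
      (Polynomial.map_ne_zero_iff hinj).2 ih.1
    rw [Function.iterate_succ_apply', twistPoly_twistShift]
    refine ⟨mul_ne_zero X_ne_zero h0, ?_⟩
    rw [natDegree_X_mul h0, natDegree_map_eq_of_injective hinj, ih.2]
    ring

/-- Terms of pairwise incongruent degrees do not cancel. -/
theorem sum_expand_mul_ne_zero [IsDomain S] {v : Fin (M + 1) → S[X]} (hv : v ≠ 0)
    (g : Fin (M + 1) → S[X]) (d : ℕ) (hg : ∀ i, g i ≠ 0 ∧ (g i).natDegree = i + d) :
    ∑ i, expand S (M + 1) (v i) * g i ≠ 0 := by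
  obtain ⟨i₀, hi₀⟩ := Function.ne_iff.1 hv
  have hne : ∀ i, v i ≠ 0 → expand S (M + 1) (v i) * g i ≠ 0 := fun i hi =>
    mul_ne_zero ((expand_ne_zero M.succ_pos).2 hi) (hg i).1
  intro h
  have hdeg := degree_sum_eq_of_disjoint (fun i => expand S (M + 1) (v i) * g i) Finset.univ (by
    rintro i ⟨-, hi⟩ j ⟨-, hj⟩ hij hd
    refine hij (Fin.ext ?_)
    have hd' := natDegree_eq_of_degree_eq hd
    simp only at hd' hi hj
    rw [natDegree_mul (left_ne_zero_of_mul hi) (hg i).1,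
      natDegree_mul (left_ne_zero_of_mul hj) (hg j).1, natDegree_expand, natDegree_expand,
      (hg i).2, (hg j).2] at hd'
    have hm := congrArg (· % (M + 1)) (show (v i).natDegree * (M + 1) + i
      = (v j).natDegree * (M + 1) + j by lia)
    simpa [Nat.mod_eq_of_lt i.2, Nat.mod_eq_of_lt j.2] using hm)
  rw [h, degree_zero] at hdeg
  have hle := Finset.le_sup (f := fun i => degree (expand S (M + 1) (v i) * g i))
    (Finset.mem_univ i₀)
  rw [← hdeg, le_bot_iff] at hle
  exact hne i₀ hi₀ (degree_eq_bot.1 hle)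

theorem twistPoly_ne_zero [IsDomain S] {w : Fin (M + 1) → S[X]} (hw : w ≠ 0) :
    twistPoly w ≠ 0 :=
  sum_expand_mul_ne_zero hw _ 0 fun i => ⟨pow_ne_zero _ X_ne_zero, by simp⟩

theorem det_twistMatrix_ne_zero [IsDomain S] (hinj : Function.Injective σ)
    {w : Fin (M + 1) → S[X]} (hw : w ≠ 0) : (twistMatrix σ w).det ≠ 0 := by
  intro h
  obtain ⟨v, hv, h0⟩ := Matrix.exists_mulVec_eq_zero_iff.2 h
  rw [twistMatrix_mulVec] at h0
  have := congrArg twistPoly h0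
  rw [twistPoly_sum_smul] at this
  refine sum_expand_mul_ne_zero hv _ (twistPoly w).natDegree
    (fun i => natDegree_twistPoly_iterate σ hinj w (twistPoly_ne_zero hw) i) (this.trans ?_)
  simp [twistPoly]

end Twist

section RankDvd

variable {S : Type*} [CommRing S] (σ : S →+* S) {M : ℕ} {m n : Type*}

/-- `twistShift` on a family of vectors. -/
noncomputable def twistShiftProd (v : Fin (M + 1) × n → S[X]) : Fin (M + 1) × n → S[X] :=
  fun x => twistShift σ (fun i => v (i, x.2)) x.1

theorem iterate_twistShiftProd_apply (v : Fin (M + 1) × n → S[X]) (k : ℕ) (i : Fin (M + 1))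
    (x : n) : (twistShiftProd σ)^[k] v (i, x) = (twistShift σ)^[k] (fun i => v (i, x)) i := by
  induction k generalizing i with
  | zero => rfl
  | succ k ih =>
    rw [Function.iterate_succ_apply', Function.iterate_succ_apply', twistShiftProd]
    simp only [ih]

/-- The rank of a matrix over a cyclic division algebra, viewed as a block matrix over a splitting
field, is divisible by the degree of the algebra. -/
theorem exists_rank_eq_mul_of_commute_twistShiftProd [Fintype n] [IsDomain S]
    (hinj : Function.Injective σ)
    (F : Type*) [Field F] [Algebra S[X] F] [IsFractionRing S[X] F]
    (A : Matrix (Fin (M + 1) × m) (Fin (M + 1) × n) S[X])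
    (hA : ∀ v, A.mulVec (twistShiftProd σ v) = twistShiftProd σ (A.mulVec v)) :
    ∃ r, (A.map (algebraMap S[X] F)).rank = (M + 1) * r := by
  classical
  let P : Finset n → Prop := fun I =>
    ∀ v, (∀ x, x.2 ∉ I → v x = 0) → A.mulVec v = 0 → v = 0
  obtain ⟨I, hI, hmax⟩ := Finset.exists_max_image (Finset.univ.filter P) Finset.card
    ⟨∅, (Finset.mem_filter_univ _).2 fun v h _ =>
      _root_.funext fun x => h x (Finset.notMem_empty _)⟩
  rw [Finset.mem_filter_univ] at hI
  let g : Fin (M + 1) × I → Fin (M + 1) × n := fun x => (x.1, x.2)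
  let ext : (Fin (M + 1) × I → S[X]) → Fin (M + 1) × n → S[X] :=
    fun v x => if hx : x.2 ∈ I then v (x.1, ⟨x.2, hx⟩) else 0
  have hext : ∀ v y, A.mulVec (ext v) y = ∑ x, A y (g x) * v x := by
    intro v y
    simp only [Matrix.mulVec, dotProduct, Fintype.sum_prod_type]
    refine Finset.sum_congr rfl fun i _ => ?_
    rw [← Finset.sum_subset (Finset.subset_univ I), ← Finset.sum_coe_sort I]
    · refine Finset.sum_congr rfl fun x _ => ?_
      simp [ext, g]
    · intro x _ hx
      simp [ext, hx]
  let B := A.map (algebraMap S[X] F)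
  have hli : LinearIndependent F (fun x => B.col (g x)) := by
    rw [← LinearIndependent.iff_fractionRing S[X] F, Fintype.linearIndependent_iff]
    intro v hv
    have h0 : ext v = 0 := by
      refine hI _ (fun x hx => by simp [ext, hx]) (funext fun y => ?_)
      have hy := congrFun hv y
      simp only [Finset.sum_apply, Pi.smul_apply, Matrix.col_apply, B, Matrix.map_apply,
        Pi.zero_apply] at hy
      simp only [Algebra.smul_def, ← map_mul, ← map_sum] at hy
      rw [hext, Pi.zero_apply]
      refine IsFractionRing.injective S[X] F ?_
      rw [map_zero, ← hy]
      exact congrArg _ (Finset.sum_congr rfl fun x _ => mul_comm _ _)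
    intro x
    simpa [ext, g] using congrFun h0 (g x)
  have hmem : ∀ x, B.col x ∈ Submodule.span F (Set.range fun x => B.col (g x)) := by
    rintro ⟨a, j⟩
    by_cases hj : j ∈ I
    · exact Submodule.subset_span ⟨(a, ⟨j, hj⟩), rfl⟩
    have hnP : ¬ P (insert j I) := fun h => by
      have := hmax (insert j I) ((Finset.mem_filter_univ _).2 h)
      rw [Finset.card_insert_of_notMem hj] at this
      lia
    simp only [P, not_forall] at hnP
    obtain ⟨v, hv, hAv, hv0⟩ := hnP
    have hvj : (fun i => v (i, j)) ≠ 0 := fun h => hv0 <| hI v (fun ⟨i, x⟩ hx => by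
      by_cases hxj : x = j
      · subst hxj
        exact congrFun h i
      · exact hv (i, x) (by simpa [hxj] using hx)) hAv
    let D := twistMatrix σ fun i => v (i, j)
    have hD : D.det ≠ 0 := det_twistMatrix_ne_zero σ hinj hvj
    have hker : ∀ k, A.mulVec ((twistShiftProd σ)^[k] v) = 0 := by
      intro k
      induction k with
      | zero => exact hAv
      | succ k ih =>
        rw [Function.iterate_succ_apply', hA, ih]
        funext x
        exact congrFun (twistShift_zero σ) x.1
    let z : Fin (M + 1) × n → S[X] := ∑ b, D.adjugate b a • (twistShiftProd σ)^[(b : ℕ)] v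
    have hz : A.mulVec z = 0 := by
      simp only [z, Matrix.mulVec_sum, Matrix.mulVec_smul, hker, smul_zero, Finset.sum_const_zero]
    have hzj : ∀ i, z (i, j) = if i = a then D.det else 0 := by
      intro i
      have := congrFun (congrFun D.mul_adjugate i) a
      simp only [Matrix.smul_apply, Matrix.one_apply, smul_eq_mul, mul_ite, mul_one,
        mul_zero] at this
      rw [← this, Matrix.mul_apply]
      simp only [z, Finset.sum_apply, Pi.smul_apply, iterate_twistShiftProd_apply, smul_eq_mul]
      exact Finset.sum_congr rfl fun b _ => mul_comm _ _
    have hzI : ∀ i x, x ∉ I → x ≠ j → z (i, x) = 0 := by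
      intro i x hx hxj
      simp only [z, Finset.sum_apply, Pi.smul_apply, iterate_twistShiftProd_apply, smul_eq_mul]
      refine Finset.sum_eq_zero fun b _ => ?_
      have : (fun i => v (i, x)) = 0 := funext fun i => hv (i, x) (by simp [hx, hxj])
      rw [this, iterate_twistShift_zero, Pi.zero_apply, mul_zero]
    have hdecomp : z = ext (fun x => z (g x)) + Pi.single (a, j) D.det := by
      funext ⟨i, x⟩
      by_cases hx : x ∈ I
      · have hxj : x ≠ j := fun h => hj (h ▸ hx)
        simp [ext, g, hx, hxj]
      · by_cases hxj : x = j
        · subst hxj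
          simp [ext, hx, hzj, Pi.single_apply]
        · simp [ext, hx, hzI i x hx hxj, hxj]
    have hcol : algebraMap S[X] F D.det • B.col (a, j)
        = ∑ x, (-algebraMap S[X] F (z (g x))) • B.col (g x) := by
      funext y
      have hy : (∑ x, A y (g x) * z (g x)) + A.mulVec (Pi.single (a, j) D.det) y = 0 := by
        have hz' := hz
        rw [hdecomp, Matrix.mulVec_add] at hz'
        exact (congrArg (· + _) (hext (fun x => z (g x)) y).symm).trans (congrFun hz' y)
      rw [Matrix.mulVec_single] at hy
      have hy' := congrArg (algebraMap S[X] F) hy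
      simp only [map_zero, map_add, map_sum, map_mul, Pi.smul_apply,
        MulOpposite.smul_eq_mul_unop, MulOpposite.unop_op, Matrix.col_apply] at hy'
      simp only [Finset.sum_apply, Pi.smul_apply, smul_eq_mul, Matrix.col_apply, B,
        Matrix.map_apply, neg_mul, Finset.sum_neg_distrib]
      rw [mul_comm, eq_neg_iff_add_eq_zero, add_comm, ← hy']
      congr 1
      exact Finset.sum_congr rfl fun x _ => mul_comm _ _
    have hD' : algebraMap S[X] F D.det ≠ 0 := by
      rwa [map_ne_zero_iff _ (IsFractionRing.injective S[X] F)]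
    rw [← Submodule.smul_mem_iff _ hD', hcol]
    exact Submodule.sum_mem _ fun x _ => Submodule.smul_mem _ _ (Submodule.subset_span ⟨x, rfl⟩)
  refine ⟨I.card, ?_⟩
  have hspan : Submodule.span F (Set.range B.col)
      = Submodule.span F (Set.range fun x => B.col (g x)) :=
    le_antisymm (Submodule.span_le.2 (Set.range_subset_iff.2 hmem))
      (Submodule.span_mono (Set.range_subset_iff.2 fun x => ⟨g x, rfl⟩))
  rw [Matrix.rank_eq_finrank_span_cols, hspan, finrank_span_eq_card hli]
  simp

end RankDvd

section Blowup

variable {R ι κ κ' m n : Type*} [Fintype ι] [CommSemiring R]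

/-- The matrix `∑ k, T k ⊗ A k`. -/
def blowup (A : ι → Matrix m n R) (T : ι → Matrix κ κ' R) : Matrix (κ × m) (κ' × n) R :=
  Matrix.of fun x y => ∑ k, T k x.1 y.1 * A k x.2 y.2

theorem blowup_apply (A : ι → Matrix m n R) (T : ι → Matrix κ κ' R) (x y) :
    blowup A T x y = ∑ k, T k x.1 y.1 * A k x.2 y.2 := rfl

theorem blowup_map {R' : Type*} [CommSemiring R'] (e : R →+* R') (A : ι → Matrix m n R)
    (T : ι → Matrix κ κ' R) :
    (blowup A T).map e = blowup (fun k => (A k).map e) fun k => (T k).map e := by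
  ext x y
  simp [blowup_apply]

theorem blowup_mulVec [Fintype κ'] [Fintype n] (A : ι → Matrix m n R) (T : ι → Matrix κ κ' R)
    (v : κ' × n → R) (x : κ × m) :
    (blowup A T).mulVec v x
      = ∑ k, ∑ y, A k x.2 y * (T k).mulVec (fun j => v (j, y)) x.1 := by
  simp only [Matrix.mulVec, dotProduct, blowup_apply, Fintype.sum_prod_type, Finset.sum_mul,
    Finset.mul_sum]
  rw [Finset.sum_comm, Finset.sum_comm (s := (Finset.univ : Finset ι))]
  refine Finset.sum_congr rfl fun y _ => ?_
  rw [Finset.sum_comm]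
  exact Finset.sum_congr rfl fun k _ => Finset.sum_congr rfl fun j _ => by ring

end Blowup

section Regularity

theorem exists_eval_eval_C_ne_zero {R : Type*} [CommRing R] [IsDomain R] [Infinite R]
    {δ : R[X][X]} (hδ : δ ≠ 0) : ∃ u y : R, eval u (eval (C y) δ) ≠ 0 := by
  obtain ⟨y, hy⟩ : ∃ y : R, eval (C y) δ ≠ 0 := by
    by_contra! h
    refine hδ (eq_zero_of_infinite_isRoot δ ?_)
    exact (Set.infinite_range_of_injective (C_injective (R := R))).mono
      (Set.range_subset_iff.2 h)
  obtain ⟨u, hu⟩ : ∃ u : R, eval u (eval (C y) δ) ≠ 0 := by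
    by_contra! h
    exact hy (Polynomial.funext (by simpa using h))
  exact ⟨u, y, hu⟩

theorem compRingHom_C_mul_X_pow {R : Type*} [CommRing R] (ω : R) (k : ℕ) :
    (compRingHom (C ω * X)) ^ k = compRingHom (C (ω ^ k) * X) := by
  induction k with
  | zero => ext <;> simp
  | succ k ih =>
    rw [pow_succ', ih]
    ext <;> simp [pow_succ, mul_assoc]

variable {ι m n : Type*} [Fintype ι] [Fintype n] {M : ℕ}

theorem blowup_twistMatrix_mulVec {S : Type*} [CommRing S] (σ : S →+* S) (hσ : σ ^ (M + 1) = 1)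
    (A : ι → Matrix m n S) (hA : ∀ k x y, σ (A k x y) = A k x y) (w : ι → Fin (M + 1) → S[X])
    (v : Fin (M + 1) × n → S[X]) :
    (blowup (fun k => (A k).map C) fun k => twistMatrix σ (w k)).mulVec (twistShiftProd σ v)
      = twistShiftProd σ
        ((blowup (fun k => (A k).map C) fun k => twistMatrix σ (w k)).mulVec v) := by
  funext x
  have h : (fun i => (blowup (fun k => (A k).map C) fun k => twistMatrix σ (w k)).mulVec v
      (i, x.2)) = ∑ k, ∑ y, C (A k x.2 y) • (twistMatrix σ (w k)).mulVec fun j => v (j, y) := by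
    funext i
    simp [blowup_mulVec]
  rw [twistShiftProd, h, blowup_mulVec]
  simp only [twistShift_sum, twistShift_smul, map_C, hA, Finset.sum_apply, Pi.smul_apply,
    smul_eq_mul, Matrix.map_apply, ← twistMatrix_mulVec_twistShift σ hσ]
  rfl

/-- Regularity: the maximal rank of the blow-ups of level `M + 1` is divisible by `M + 1`. -/
theorem exists_mul_le_rank_blowup [Fintype m] (A : ι → Matrix m n ℂ)
    (T : ι → Matrix (Fin (M + 1)) (Fin (M + 1)) ℂ) {k : ℕ}
    (hT : (M + 1) * k < (blowup A T).rank) :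
    ∃ T' : ι → Matrix (Fin (M + 1)) (Fin (M + 1)) ℂ,
      (M + 1) * (k + 1) ≤ (blowup A T').rank := by
  obtain ⟨ω, hω⟩ : ∃ ω : ℂ, IsPrimitiveRoot ω (M + 1) :=
    ⟨_, Complex.isPrimitiveRoot_exp (M + 1) M.succ_ne_zero⟩
  let σ : ℂ[X] →+* ℂ[X] := compRingHom (C ω * X)
  have hσ : σ ^ (M + 1) = 1 := by
    rw [compRingHom_C_mul_X_pow, hω.pow_eq_one]
    ext <;> simp
  have hinj : Function.Injective σ := by
    refine Function.LeftInverse.injective (g := σ ^ M) fun x => ?_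
    exact congrArg (fun f : ℂ[X] →+* ℂ[X] => f x) ((pow_succ σ M).symm.trans hσ)
  have hωinj : Set.InjOn (fun j : Fin (M + 1) => ω ^ (j : ℕ))
      (Finset.univ : Finset (Fin (M + 1))) :=
    fun i _ j _ h => Fin.ext (hω.pow_inj i.2 j.2 h)
  let w : ι → Fin (M + 1) → ℂ[X][X] := fun k l =>
    C (Lagrange.interpolate Finset.univ (fun j : Fin (M + 1) => ω ^ (j : ℕ))
      fun j => T k (l + j) j)
  let e : ℂ → ℂ → ℂ[X][X] →+* ℂ := fun u y => (evalRingHom u).comp (evalRingHom (C y))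
  have hw : ∀ k, (twistMatrix σ (w k)).map (e 1 1) = T k := by
    intro k
    ext i j
    have hij : (i : ℕ) + (M + 1) * (((i - j : Fin (M + 1)) + j : ℕ) / (M + 1))
        = j + (i - j : Fin (M + 1)) := by
      have h1 : (((i - j : Fin (M + 1)) + j : ℕ) % (M + 1)) = i := by
        rw [← Fin.val_add, sub_add_cancel]
      have := Nat.mod_add_div ((i - j : Fin (M + 1)) + j : ℕ) (M + 1)
      rw [h1] at this
      rw [this, add_comm]
    rw [Matrix.map_apply, twistMatrix, Matrix.of_apply, iterate_twistShift_apply σ _ _ _ _ _ hij,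
      compRingHom_C_mul_X_pow]
    have h2 := Lagrange.eval_interpolate_at_node (fun j' : Fin (M + 1) => T k (i - j + j') j')
      hωinj (Finset.mem_univ j)
    simp only [sub_add_cancel] at h2
    simp [e, w, ← h2, -Lagrange.interpolate_apply]
  let Y := blowup (fun k => ((A k).map C).map C) fun k => twistMatrix σ (w k)
  have hY : ∀ u y, Y.map (e u y) = blowup A fun k => (twistMatrix σ (w k)).map (e u y) := by
    intro u y
    rw [blowup_map]
    congr
    ext
    simp [e]
  obtain ⟨r, hr⟩ := exists_rank_eq_mul_of_commute_twistShiftProd σ hinj (FractionRing ℂ[X][X]) Y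
    (blowup_twistMatrix_mulVec σ hσ _ (fun k x y => by simp [σ]) w)
  have hle := Matrix.rank_map_le_rank_map_algebraMap (FractionRing ℂ[X][X]) Y (e 1 1)
  simp only [hY, hw, hr] at hle
  have hkr : k < r := lt_of_mul_lt_mul_left' (hT.trans_le hle)
  obtain ⟨δ, hδ, h⟩ := Y.exists_rank_map_algebraMap_le_rank_map (K := ℂ) (FractionRing ℂ[X][X])
  obtain ⟨u, y, huy⟩ := exists_eval_eval_C_ne_zero hδ
  refine ⟨fun k => (twistMatrix σ (w k)).map (e u y), ?_⟩
  rw [← hY]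
  exact ((Nat.mul_le_mul_left _ hkr).trans_eq hr.symm).trans (h (e u y) huy)

end Regularity

end CyclicAlgebra

section ShrunkSubspace

variable {K : Type*} [Field K]

theorem Submodule.finrank_map_add_finrank_inf_ker {V W : Type*} [AddCommGroup V] [Module K V]
    [FiniteDimensional K V] [AddCommGroup W] [Module K W] (p : Submodule K V) (f : V →ₗ[K] W) :
    Module.finrank K (p.map f) + Module.finrank K ↥(p ⊓ LinearMap.ker f) = Module.finrank K p := by
  have h := LinearMap.finrank_range_add_finrank_ker (f.domRestrict p)
  have h1 : LinearMap.range (f.domRestrict p) = p.map f := by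
    rw [LinearMap.domRestrict, LinearMap.range_comp, Submodule.range_subtype]
  have h2 : (LinearMap.ker (f.domRestrict p)).map p.subtype = p ⊓ LinearMap.ker f := by
    rw [LinearMap.domRestrict, LinearMap.ker_comp, Submodule.map_comap_eq, Submodule.range_subtype]
  rw [← h, h1, ← h2, Submodule.finrank_map_subtype_eq]

theorem Matrix.rank_add_finrank_ker {m n : Type*} [Fintype n] (X : Matrix m n K) :
    X.rank + Module.finrank K (LinearMap.ker X.mulVecLin) = Fintype.card n := by
  rw [Matrix.rank, LinearMap.finrank_range_add_finrank_ker, Module.finrank_fintype_fun_eq_card]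

/-- If an upper triangular block matrix has the smallest rank allowed by its diagonal blocks, then
the off-diagonal block maps the kernel of one diagonal block into the range of the other. -/
theorem Matrix.exists_mulVec_eq_of_rank_fromBlocks_le {m₁ m₂ n₁ n₂ : Type*} [Fintype n₁]
    [Fintype n₂] (X : Matrix m₁ n₁ K) (B : Matrix m₁ n₂ K) (Y : Matrix m₂ n₂ K)
    (h : (Matrix.fromBlocks X B 0 Y).rank ≤ X.rank + Y.rank) :
    (Matrix.fromBlocks X B 0 Y).rank = X.rank + Y.rank ∧
      ∀ v, Y.mulVec v = 0 → ∃ u, X.mulVec u = B.mulVec v := by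
  set Q := Matrix.fromBlocks X B 0 Y with hQ
  let P : (n₁ ⊕ n₂ → K) →ₗ[K] n₂ → K := LinearMap.funLeft K K Sum.inr
  let E : (n₁ → K) →ₗ[K] n₁ ⊕ n₂ → K :=
    { toFun := fun u => Sum.elim u 0
      map_add' := fun u v => by ext (i | i) <;> simp
      map_smul' := fun c v => by ext (i | i) <;> simp }
  have hE : Function.Injective E := fun u v huv => funext fun i => congrFun huv (Sum.inl i)
  have hker : ∀ x, x ∈ LinearMap.ker Q.mulVecLin ↔
      X.mulVec (x ∘ Sum.inl) + B.mulVec (x ∘ Sum.inr) = 0 ∧ Y.mulVec (x ∘ Sum.inr) = 0 := by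
    intro x
    rw [LinearMap.mem_ker, Matrix.mulVecLin_apply, hQ, Matrix.fromBlocks_mulVec,
      Matrix.zero_mulVec, zero_add, ← Sum.elim_zero_zero, Sum.elim_eq_iff]
  have h1 : LinearMap.ker Q.mulVecLin ⊓ LinearMap.ker P = (LinearMap.ker X.mulVecLin).map E := by
    ext x
    simp only [Submodule.mem_inf, hker, Submodule.mem_map, LinearMap.mem_ker,
      Matrix.mulVecLin_apply]
    constructor
    · rintro ⟨⟨hx, -⟩, hP⟩
      have hP' : x ∘ Sum.inr = 0 := hP
      refine ⟨x ∘ Sum.inl, by simpa [hP'] using hx, ?_⟩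
      exact (congrArg (Sum.elim _) hP'.symm).trans (Sum.elim_comp_inl_inr x)
    · rintro ⟨u, hu, rfl⟩
      have h1 : E u ∘ Sum.inl = u := rfl
      have h2 : E u ∘ Sum.inr = 0 := rfl
      exact ⟨⟨by rw [h1, h2, hu, Matrix.mulVec_zero, add_zero], by rw [h2, Matrix.mulVec_zero]⟩, h2⟩
  have h2 : (LinearMap.ker Q.mulVecLin).map P ≤ LinearMap.ker Y.mulVecLin := by
    rintro _ ⟨x, hx, rfl⟩
    exact ((hker x).1 hx).2
  have h3 := Submodule.finrank_map_add_finrank_inf_ker (LinearMap.ker Q.mulVecLin) P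
  rw [h1, ← (Submodule.equivMapOfInjective E hE _).finrank_eq] at h3
  have h4 := Submodule.finrank_mono h2
  have hQr := Q.rank_add_finrank_ker
  have hXr := X.rank_add_finrank_ker
  have hYr := Y.rank_add_finrank_ker
  rw [Fintype.card_sum] at hQr
  refine ⟨by lia, fun v hv => ?_⟩
  have h5 := Submodule.eq_of_le_of_finrank_le h2 (by lia)
  have hv' : v ∈ LinearMap.ker Y.mulVecLin := hv
  rw [← h5] at hv'
  obtain ⟨x, hx, rfl⟩ := hv'
  refine ⟨-(x ∘ Sum.inl), ?_⟩
  rw [Matrix.mulVec_neg]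
  exact neg_eq_of_add_eq_zero_right ((hker x).1 hx).1

variable {ι m n : Type*} [Fintype ι] [Fintype n]

theorem rank_blowup_submatrix {κ κ' : Type*} [Fintype κ] [Fintype κ'] (A : ι → Matrix m n K)
    (T : ι → Matrix κ κ K) (e : κ' ≃ κ) :
    (blowup A fun k => (T k).submatrix e e).rank = (blowup A T).rank :=
  (blowup A T).rank_submatrix (e.prodCongr (Equiv.refl m)) (e.prodCongr (Equiv.refl n))

theorem rank_blowup_fromBlocks {κ κ' : Type*} [Fintype κ] [Fintype κ'] (A : ι → Matrix m n K)
    (T : ι → Matrix κ κ K) (B : ι → Matrix κ κ' K) (T' : ι → Matrix κ' κ' K) :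
    (blowup A fun k => Matrix.fromBlocks (T k) (B k) 0 (T' k)).rank
      = (Matrix.fromBlocks (blowup A T) (blowup A B) 0 (blowup A T')).rank := by
  rw [← Matrix.rank_submatrix _ (Equiv.sumProdDistrib κ κ' m).symm
    (Equiv.sumProdDistrib κ κ' n).symm]
  congr 1
  ext (x | x) (y | y) <;> simp [blowup_apply]

/-- The span of the components of the kernel vectors of the blow-ups of `A` of rank `k` times
their level. -/
def blowupKerSpan (A : ι → Matrix m n K) (k : ℕ) : Submodule K (n → K) :=
  Submodule.span K {u | ∃ (κ : Type) (_ : Fintype κ) (T : ι → Matrix κ κ K) (x : κ × n → K)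
    (c : κ), (blowup A T).rank = Fintype.card κ * k ∧ (blowup A T).mulVec x = 0 ∧
      u = fun y => x (c, y)}

/-- Families of vectors of a subspace. -/
def Submodule.prodPow (κ : Type*) (U : Submodule K (n → K)) : Submodule K (κ × n → K) where
  carrier := {x | ∀ c, (fun y => x (c, y)) ∈ U}
  add_mem' hx hy c := U.add_mem (hx c) (hy c)
  zero_mem' _ := U.zero_mem
  smul_mem' r _ hx c := U.smul_mem r (hx c)

theorem Submodule.finrank_prodPow (κ : Type*) [Fintype κ] (U : Submodule K (n → K)) :
    Module.finrank K (U.prodPow κ) = Fintype.card κ * Module.finrank K U := by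
  let e : U.prodPow κ ≃ₗ[K] (κ → U) :=
    { toFun := fun x c => ⟨fun y => x.1 (c, y), x.2 c⟩
      invFun := fun f => ⟨fun y => (f y.1).1 y.2, fun c => (f c).2⟩
      map_add' := fun _ _ => rfl
      map_smul' := fun _ _ => rfl
      left_inv := fun _ => rfl
      right_inv := fun _ => rfl }
  rw [e.finrank_eq, Module.finrank_pi_fintype, Finset.sum_const, Finset.card_univ, smul_eq_mul]

theorem exists_blowup_mulVec_eq (A : ι → Matrix m n K) (k : ℕ)
    (hmax : ∀ (κ : Type) [Fintype κ] (T : ι → Matrix κ κ K),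
      (blowup A T).rank ≤ Fintype.card κ * k)
    {κ : Type} [Fintype κ] [DecidableEq κ] (T : ι → Matrix κ κ K)
    (hT : (blowup A T).rank = Fintype.card κ * k) {u : n → K} (hu : u ∈ blowupKerSpan A k)
    (a : κ) (l : ι) :
    ∃ y ∈ (blowupKerSpan A k).prodPow κ,
      (blowup A T).mulVec y = fun z => if z.1 = a then (A l).mulVec u z.2 else 0 := by
  classical
  induction hu using Submodule.span_induction with
  | mem u hu =>
    obtain ⟨κ', _, T', x, c, hT', hx, rfl⟩ := hu
    let B : ι → Matrix κ κ' K := Pi.single l (Matrix.single a c 1)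
    have hB : (blowup A B).mulVec x
        = fun z => if z.1 = a then (A l).mulVec (fun y => x (c, y)) z.2 else 0 := by
      funext z
      rw [blowup_mulVec, Finset.sum_eq_single l]
      · split_ifs with hz <;>
          simp [B, hz, Matrix.mulVec, dotProduct, Matrix.single_apply, eq_comm (a := a)]
      · intro b _ hb
        simp [B, hb]
      · simp
    have hle := hmax _ fun k => Matrix.fromBlocks (T k) (B k) 0 (T' k)
    rw [rank_blowup_fromBlocks, Fintype.card_sum, add_mul, ← hT, ← hT'] at hle
    obtain ⟨hrank, hsol⟩ := Matrix.exists_mulVec_eq_of_rank_fromBlocks_le _ _ _ hle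
    obtain ⟨y, hy⟩ := hsol x hx
    refine ⟨y, fun d => ?_, hy.trans hB⟩
    refine Submodule.subset_span ⟨κ ⊕ κ', inferInstance,
      fun k => Matrix.fromBlocks (T k) (B k) 0 (T' k),
      fun z => Sum.elim (fun i => y (i, z.2)) (fun i => - x (i, z.2)) z.1, Sum.inl d, ?_, ?_, rfl⟩
    · rw [rank_blowup_fromBlocks, hrank, hT, hT', Fintype.card_sum, add_mul]
    · have hy' := congrFun hy
      have hx' := congrFun hx
      simp only [Matrix.mulVec, dotProduct, blowup_apply, Fintype.sum_prod_type,
        Pi.zero_apply] at hy' hx'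
      ext ⟨z | z, t⟩
      · simp [Matrix.mulVec, dotProduct, blowup_apply, Fintype.sum_prod_type, hy' (z, t)]
      · simp [Matrix.mulVec, dotProduct, blowup_apply, Fintype.sum_prod_type, hx' (z, t)]
  | zero =>
    refine ⟨0, Submodule.zero_mem _, ?_⟩
    ext z
    simp
  | add u v _ _ hu hv =>
    obtain ⟨y, hy, hyu⟩ := hu
    obtain ⟨y', hy', hyv⟩ := hv
    refine ⟨y + y', Submodule.add_mem _ hy hy', ?_⟩
    rw [Matrix.mulVec_add, hyu, hyv]
    ext z
    by_cases hz : z.1 = a <;> simp [hz, Matrix.mulVec_add]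
  | smul r u _ hu =>
    obtain ⟨y, hy, hyu⟩ := hu
    refine ⟨r • y, Submodule.smul_mem _ r hy, ?_⟩
    rw [Matrix.mulVec_smul, hyu]
    ext z
    by_cases hz : z.1 = a <;> simp [hz, Matrix.mulVec_smul]

theorem finrank_iSup_map_blowupKerSpan_lt (A : ι → Matrix m n K) [Fintype m] (k : ℕ)
    (hk : k < Fintype.card n)
    (hmax : ∀ (κ : Type) [Fintype κ] (T : ι → Matrix κ κ K),
      (blowup A T).rank ≤ Fintype.card κ * k)
    {κ : Type} [Fintype κ] [Nonempty κ] (T : ι → Matrix κ κ K)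
    (hT : (blowup A T).rank = Fintype.card κ * k) :
    Module.finrank K ↥(⨆ l, (blowupKerSpan A k).map (A l).mulVecLin)
      < Module.finrank K (blowupKerSpan A k) := by
  classical
  set U := blowupKerSpan A k
  set W := ⨆ l, U.map (A l).mulVecLin
  have hker : LinearMap.ker (blowup A T).mulVecLin ≤ U.prodPow κ := fun x hx c =>
    Submodule.subset_span ⟨κ, inferInstance, T, x, c, hT, hx, rfl⟩
  have hsingle : ∀ (a : κ), ∀ w ∈ W, ∃ y ∈ U.prodPow κ,
      (blowup A T).mulVec y = fun z => if z.1 = a then w z.2 else 0 := by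
    intro a w hw
    induction hw using Submodule.iSup_induction' with
    | mem l w hw =>
      obtain ⟨u, hu, rfl⟩ := hw
      exact exists_blowup_mulVec_eq A k hmax T hT hu a l
    | zero =>
      refine ⟨0, Submodule.zero_mem _, ?_⟩
      ext z
      simp
    | add u v _ _ hu hv =>
      obtain ⟨y, hy, hyu⟩ := hu
      obtain ⟨y', hy', hyv⟩ := hv
      refine ⟨y + y', Submodule.add_mem _ hy hy', ?_⟩
      rw [Matrix.mulVec_add, hyu, hyv]
      ext z
      by_cases hz : z.1 = a <;> simp [hz]
  have hW : W.prodPow κ ≤ (U.prodPow κ).map (blowup A T).mulVecLin := by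
    intro w hw
    choose y hy hyw using fun a => hsingle a _ (hw a)
    refine ⟨∑ a, y a, Submodule.sum_mem _ fun a _ => hy a, ?_⟩
    rw [map_sum]
    ext z
    simp [hyw]
  have h1 := Submodule.finrank_map_add_finrank_inf_ker (U.prodPow κ) (blowup A T).mulVecLin
  rw [inf_eq_right.2 hker] at h1
  have h2 := Submodule.finrank_mono hW
  have h3 := (blowup A T).rank_add_finrank_ker
  rw [hT, Fintype.card_prod] at h3
  rw [Submodule.finrank_prodPow] at h1 h2
  have h4 := Nat.mul_lt_mul_of_pos_left hk (Fintype.card_pos (α := κ))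
  exact lt_of_mul_lt_mul_left' (a := Fintype.card κ) (by lia)

/-- Either some blow-up of `A` has full column rank, or `A` has a shrunk subspace. -/
theorem exists_blowup_rank_eq_or_exists_finrank_iSup_map_lt [Fintype m] (A : ι → Matrix m n ℂ) :
    (∃ (M : ℕ) (T : ι → Matrix (Fin (M + 1)) (Fin (M + 1)) ℂ),
      (M + 1) * Fintype.card n ≤ (blowup A T).rank) ∨
    ∃ U : Submodule ℂ (n → ℂ),
      Module.finrank ℂ ↥(⨆ l, U.map (A l).mulVecLin) < Module.finrank ℂ U := by
  classical
  let P : ℕ → Prop := fun k => ∃ (M : ℕ) (T : ι → Matrix (Fin (M + 1)) (Fin (M + 1)) ℂ),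
    (M + 1) * k ≤ (blowup A T).rank
  have hbound : ∀ k, P k → k ≤ Fintype.card n := by
    rintro k ⟨M, T, h⟩
    have := h.trans (blowup A T).rank_le_card_width
    rw [Fintype.card_prod, Fintype.card_fin] at this
    exact le_of_mul_le_mul_left this M.succ_pos
  set k := Nat.findGreatest P (Fintype.card n) with hk
  have hPk : P k := Nat.findGreatest_spec (m := 0) (Nat.zero_le _) ⟨0, 0, by simp⟩
  have hnot : ¬ P (k + 1) := fun h => by
    have := Nat.le_findGreatest (hbound _ h) h
    lia
  have hmax : ∀ (M : ℕ) (T : ι → Matrix (Fin (M + 1)) (Fin (M + 1)) ℂ),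
      (blowup A T).rank ≤ (M + 1) * k := by
    intro M T
    by_contra! h
    exact hnot ⟨M, exists_mul_le_rank_blowup A T h⟩
  have hmax' : ∀ (κ : Type) [Fintype κ] (T : ι → Matrix κ κ ℂ),
      (blowup A T).rank ≤ Fintype.card κ * k := by
    intro κ _ T
    rcases hκ : Fintype.card κ with _ | M
    · have := (blowup A T).rank_le_card_width
      rw [Fintype.card_prod, hκ, zero_mul] at this
      exact this.trans (Nat.zero_le _)
    · rw [← rank_blowup_submatrix A T (Fintype.equivFinOfCardEq hκ).symm]
      exact hmax M _
  obtain ⟨M, T, hT⟩ := hPk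
  rcases (hbound k ⟨M, T, hT⟩).eq_or_lt with h | h
  · exact Or.inl ⟨M, T, h ▸ hT⟩
  · refine Or.inr ⟨_, finrank_iSup_map_blowupKerSpan_lt A k h hmax' T ?_⟩
    rw [Fintype.card_fin]
    exact le_antisymm (hmax M T) hT

end ShrunkSubspace

section Bipartite

variable {p q : ℕ} {a : Fin p → ℕ} {b : Fin q → ℕ}
  (m : ∀ (i : Fin p) (j : Fin q), Matrix (Fin (b j)) (Fin (a i)) ℂ)

/-- The maps of a representation of the bipartite quiver, extended by zero to the total spaces. -/
def bipartiteTotal (k : Fin p × Fin q) :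
    Matrix (Σ j, Fin (b j)) (Σ i, Fin (a i)) ℂ :=
  Matrix.of fun r c => if c.1 = k.1 ∧ r.1 = k.2 then m c.1 r.1 r.2 c.2 else 0

theorem blowup_bipartiteTotal {κ : Type*} (T : Fin p × Fin q → Matrix κ κ ℂ)
    (r : κ × Σ j, Fin (b j)) (c : κ × Σ i, Fin (a i)) :
    blowup (bipartiteTotal m) T r c = T (c.2.1, r.2.1) r.1 c.1 * m c.2.1 r.2.1 r.2.2 c.2.2 := by
  rw [blowup_apply, Finset.sum_eq_single (c.2.1, r.2.1)]
  · simp [bipartiteTotal]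
  · rintro ⟨i, j⟩ - h
    have : ¬ (c.2.1 = i ∧ r.2.1 = j) := by
      rintro ⟨rfl, rfl⟩
      exact h rfl
    simp [bipartiteTotal, this]
  · simp

/-- The sum of the vertex spaces. -/
def sigmaUncurry (b : Fin q → ℕ) :
    (∀ j, Fin (b j) → ℂ) →ₗ[ℂ] (Σ j, Fin (b j)) → ℂ where
  toFun f z := f z.1 z.2
  map_add' _ _ := rfl
  map_smul' _ _ := rfl

theorem bipartiteTotal_mulVec (i : Fin p) (j : Fin q) (u : (Σ i, Fin (a i)) → ℂ) :
    (bipartiteTotal m (i, j)).mulVec u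
      = sigmaUncurry b (Pi.single j ((m i j).mulVec fun x => u ⟨i, x⟩)) := by
  ext ⟨j', y⟩
  simp only [Matrix.mulVec, dotProduct, bipartiteTotal, Matrix.of_apply, Fintype.sum_sigma,
    sigmaUncurry, LinearMap.coe_mk, AddHom.coe_mk]
  rw [Finset.sum_eq_single i (fun i' _ h => by simp [h]) (by simp)]
  by_cases hj : j' = j
  · subst hj
    simp
    rfl
  · simp [hj]

/-- A semistable representation of the bipartite quiver has no shrunk subspace. -/
theorem finrank_le_finrank_iSup_map_bipartiteTotal
    (hss : ∀ (V' : ∀ i, Submodule ℂ (Fin (a i) → ℂ)) (W' : ∀ j, Submodule ℂ (Fin (b j) → ℂ)),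
      (∀ i j, (V' i).map (m i j).mulVecLin ≤ W' j) →
      ∑ i, Module.finrank ℂ (V' i) ≤ ∑ j, Module.finrank ℂ (W' j))
    (U : Submodule ℂ ((Σ i, Fin (a i)) → ℂ)) :
    Module.finrank ℂ U
      ≤ Module.finrank ℂ ↥(⨆ k, U.map (bipartiteTotal m k).mulVecLin) := by
  set W := ⨆ k, U.map (bipartiteTotal m k).mulVecLin
  let π : ∀ i, ((Σ i, Fin (a i)) → ℂ) →ₗ[ℂ] Fin (a i) → ℂ := fun i =>
    LinearMap.funLeft ℂ ℂ fun x => ⟨i, x⟩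
  let V' : ∀ i, Submodule ℂ (Fin (a i) → ℂ) := fun i => U.map (π i)
  let W' : ∀ j, Submodule ℂ (Fin (b j) → ℂ) := fun j => ⨆ i, (V' i).map (m i j).mulVecLin
  have hV : Module.finrank ℂ U ≤ ∑ i, Module.finrank ℂ (V' i) := by
    rw [← Module.finrank_pi_fintype]
    refine LinearMap.finrank_le_finrank_of_injective
      (f := LinearMap.pi fun i => (π i).restrict (p := U) (q := V' i)
        fun u hu => Submodule.mem_map_of_mem hu) fun u v huv => ?_
    ext ⟨i, x⟩
    exact congrFun (congrArg Subtype.val (congrFun huv i)) x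
  have hW' : ∀ j, ∀ w ∈ W' j, sigmaUncurry b (Pi.single j w) ∈ W := by
    intro j
    suffices h : W' j ≤ W.comap (sigmaUncurry b ∘ₗ LinearMap.single ℂ _ j) from fun w hw => h hw
    refine iSup_le fun i => ?_
    rintro _ ⟨_, ⟨u, hu, rfl⟩, rfl⟩
    refine Submodule.mem_iSup_of_mem (i, j) ⟨u, hu, ?_⟩
    exact bipartiteTotal_mulVec m i j u
  have hW : ∑ j, Module.finrank ℂ (W' j) ≤ Module.finrank ℂ W := by
    rw [← Module.finrank_pi_fintype]
    refine LinearMap.finrank_le_finrank_of_injective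
      (f := LinearMap.codRestrict W (sigmaUncurry b ∘ₗ
        LinearMap.pi fun j => (W' j).subtype ∘ₗ LinearMap.proj j) fun f => ?_) fun f g hfg => ?_
    · have : (LinearMap.pi fun j => (W' j).subtype ∘ₗ LinearMap.proj j) f
          = ∑ j, Pi.single j (f j : Fin (b j) → ℂ) := by
        rw [Finset.univ_sum_single]
        rfl
      rw [LinearMap.comp_apply, this, map_sum]
      exact Submodule.sum_mem _ fun j _ => hW' j _ (f j).2
    · ext j y
      exact congrFun (congrArg Subtype.val hfg) ⟨j, y⟩
  exact hV.trans ((hss V' W' fun i j =>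
    le_iSup (fun i => (V' i).map (m i j).mulVecLin) i).trans hW)

/-- Distributing a product over a disjoint union. -/
def sigmaProdEquiv (κ : Type*) (b : Fin q → ℕ) :
    ((v : κ × Fin q) × Fin (b v.2)) ≃ κ × Σ j, Fin (b j) where
  toFun z := (z.1.1, ⟨z.1.2, z.2⟩)
  invFun z := ⟨(z.1, z.2.1), z.2.2⟩
  left_inv _ := rfl
  right_inv _ := rfl

theorem Matrix.bijective_mulVecLin_of_card_le_rank {K r c : Type*} [Field K] [Fintype r]
    [Fintype c] (Q : Matrix r c K) (hcard : Fintype.card r = Fintype.card c)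
    (h : Fintype.card c ≤ Q.rank) : Function.Bijective Q.mulVecLin := by
  have hker := Q.rank_add_finrank_ker
  have hinj : Function.Injective Q.mulVecLin :=
    LinearMap.ker_eq_bot.1 (Submodule.finrank_eq_zero.1 (by lia))
  refine ⟨hinj, (LinearMap.injective_iff_surjective_of_finrank_eq_finrank ?_).1 hinj⟩
  rw [Module.finrank_fintype_fun_eq_card, Module.finrank_fintype_fun_eq_card, hcard]

end Bipartite

/-- For a θ-semistable representation of the bipartite quiver `Q_{p,q}` there is a
matrix semi-invariant not vanishing on it: some `Nn × Nn` block matrix, whose `(k,l)`-block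
is a scalar multiple `s_{kl} · m_{k mod p, l mod q}`, is invertible. -/
theorem semistable_has_nonvanishing_matrix_semiinvariant
    (p q n : ℕ) (hn : 1 ≤ n)
    (a : Fin p → ℕ) (b : Fin q → ℕ)
    (ha : ∑ i, a i = n) (hb : ∑ j, b j = n)
    (m : ∀ (i : Fin p) (j : Fin q), Matrix (Fin (b j)) (Fin (a i)) ℂ)
    (hss : ∀ (V' : ∀ i, Submodule ℂ (Fin (a i) → ℂ)) (W' : ∀ j, Submodule ℂ (Fin (b j) → ℂ)),
      (∀ i j, (V' i).map (m i j).mulVecLin ≤ W' j) →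
      ∑ i, Module.finrank ℂ (V' i) ≤ ∑ j, Module.finrank ℂ (W' j)) :
    ∃ (N : ℕ), 0 < N ∧
      ∃ s : (Fin N × Fin p) → (Fin N × Fin q) → ℂ,
        Function.Bijective
          (Matrix.mulVecLin
            (Matrix.of (fun (row : (v : Fin N × Fin q) × Fin (b v.2))
                            (col : (u : Fin N × Fin p) × Fin (a u.2)) =>
              s col.1 row.1 * m col.1.2 row.1.2 row.2 col.2))) := by
  rcases exists_blowup_rank_eq_or_exists_finrank_iSup_map_lt (bipartiteTotal m) with
    ⟨M, T, hT⟩ | ⟨U, hU⟩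
  · refine ⟨M + 1, M.succ_pos, fun u v => T (u.2, v.2) v.1 u.1, ?_⟩
    have hrow : Fintype.card ((v : Fin (M + 1) × Fin q) × Fin (b v.2)) = (M + 1) * n := by
      simp [Fintype.card_congr (sigmaProdEquiv (Fin (M + 1)) b), hb]
    have hcol : Fintype.card ((u : Fin (M + 1) × Fin p) × Fin (a u.2)) = (M + 1) * n := by
      simp [Fintype.card_congr (sigmaProdEquiv (Fin (M + 1)) a), ha]
    refine Matrix.bijective_mulVecLin_of_card_le_rank _ (hrow.trans hcol.symm) ?_
    rw [← Matrix.rank_submatrix _ (sigmaProdEquiv (Fin (M + 1)) b)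
      (sigmaProdEquiv (Fin (M + 1)) a)] at hT
    rw [hcol]
    have hcard : Fintype.card ((i : Fin p) × Fin (a i)) = n := by simp [ha]
    rw [hcard] at hT
    refine hT.trans_eq (congrArg Matrix.rank ?_)
    ext r c
    exact blowup_bipartiteTotal m T _ _
  · exact absurd (finrank_le_finrank_iSup_map_bipartiteTotal m hss U) hU.not_ge
end

section
/- Fix natural numbers k and l, and let R = ℂ[a_1,…,a_k, b_1,…,b_k, c_1,…,c_{2l}] be a polynomial ring over ℂ. Let S be the ℂ-subalgebra of R generated by the variables c_1,…,c_{2l} together with all products a_i·b_j (1≤i,j≤k). Then S is isomorphic as a ℂ-algebra to a polynomial ring (i.e. to a multivariate polynomial ring ℂ[σ] over some index type σ) if and only if k ≤ 1. -/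
open MvPolynomial

/-- The loop variables `c_t` and the products `a_i · b_j`, as a single family. -/
noncomputable def quiverCycle (k m : ℕ) :
    Fin m ⊕ Fin k × Fin k → MvPolynomial (Fin k ⊕ Fin k ⊕ Fin m) ℂ :=
  Sum.elim (fun t => X (Sum.inr (Sum.inr t)))
    (fun ij => X (Sum.inl ij.1) * X (Sum.inr (Sum.inl ij.2)))

theorem algebraicIndependent_quiverCycle {k : ℕ} (m : ℕ) (hk : k ≤ 1) :
    AlgebraicIndependent ℂ (quiverCycle k m) := by
  have : Subsingleton (Fin k) := Fin.subsingleton_iff_le_one.2 hk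
  let ψ : MvPolynomial (Fin k ⊕ Fin k ⊕ Fin m) ℂ →ₐ[ℂ]
      MvPolynomial (Fin m ⊕ Fin k × Fin k) ℂ :=
    aeval (Sum.elim (fun i => X (Sum.inr (i, i)))
      (Sum.elim (fun _ => 1) (fun t => X (Sum.inl t))))
  have hψ : ψ.comp (aeval (quiverCycle k m)) = AlgHom.id ℂ _ := by
    ext1 s
    rcases s with t | ⟨i, j⟩
    · simp [ψ, quiverCycle]
    · simp [ψ, quiverCycle, Subsingleton.elim j i]
  exact Function.LeftInverse.injective (g := ψ) fun p => DFunLike.congr_fun hψ p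

/-- Evaluation at `b = c = 0` and `a_i = z` for all `i` does not depend on `z` on the algebra
generated by the cycles. -/
theorem aeval_eq_of_mem_adjoin_quiverCycle {k m : ℕ}
    {f : MvPolynomial (Fin k ⊕ Fin k ⊕ Fin m) ℂ}
    (hf : f ∈ Algebra.adjoin ℂ (Set.range (quiverCycle k m))) (z w : ℂ) :
    aeval (Sum.elim (fun _ => z) (fun _ => (0 : ℂ))) f =
      aeval (Sum.elim (fun _ => w) (fun _ => (0 : ℂ))) f := by
  have hle : Algebra.adjoin ℂ (Set.range (quiverCycle k m)) ≤
      AlgHom.equalizer (aeval (Sum.elim (fun _ => z) (fun _ => (0 : ℂ))))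
        (aeval (Sum.elim (fun _ => w) (fun _ => (0 : ℂ)))) := by
    rw [Algebra.adjoin_le_iff]
    rintro _ ⟨t | ⟨i, j⟩, rfl⟩ <;> simp [quiverCycle]
  exact hle hf

/-- An element of a subalgebra of a polynomial ring over a field that is a unit of the
polynomial ring is a unit of the subalgebra. -/
theorem isUnit_of_isUnit_coe_mvPolynomial {σ K : Type*} [Field K]
    {S : Subalgebra K (MvPolynomial σ K)} {f : S}
    (hf : IsUnit (f : MvPolynomial σ K)) : IsUnit f := by
  obtain ⟨c, hc, hcf⟩ := MvPolynomial.isUnit_iff_eq_C_of_isReduced.1 hf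
  have : f = algebraMap K S c := Subtype.ext hcf
  rw [this]
  exact hc.map _

theorem irreducible_quiverCycle {k m : ℕ} (i j : Fin k)
    {f : Algebra.adjoin ℂ (Set.range (quiverCycle k m))}
    (hf : (f : MvPolynomial (Fin k ⊕ Fin k ⊕ Fin m) ℂ) =
      X (Sum.inl i) * X (Sum.inr (Sum.inl j))) : Irreducible f := by
  have key : ∀ g h : Algebra.adjoin ℂ (Set.range (quiverCycle k m)), f = g * h →
      (X (Sum.inl i) : MvPolynomial (Fin k ⊕ Fin k ⊕ Fin m) ℂ) ∣ g → IsUnit h := by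
    rintro g h hgh ⟨q, hq⟩
    have hgh' := congrArg Subtype.val hgh
    rw [hf, MulMemClass.coe_mul, hq, mul_assoc] at hgh'
    have hX := mul_left_cancel₀ (X_ne_zero _) hgh'
    rcases (MvPolynomial.X_prime (R := ℂ)).irreducible.isUnit_or_isUnit hX with hu | hu
    · obtain ⟨c, hc, rfl⟩ := MvPolynomial.isUnit_iff_eq_C_of_isReduced.1 hu
      have h01 := aeval_eq_of_mem_adjoin_quiverCycle g.2 1 0
      rw [hq] at h01
      simp at h01
      exact absurd h01 hc.ne_zero
    · exact isUnit_of_isUnit_coe_mvPolynomial hu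
  refine ⟨fun hu => ?_, fun g h hgh => ?_⟩
  · have hu' := hu.map (Subalgebra.val _)
    rw [Subalgebra.coe_val, hf] at hu'
    exact (MvPolynomial.X_prime (R := ℂ)).not_isUnit (isUnit_of_mul_isUnit_left hu')
  · have hdvd : (X (Sum.inl i) : MvPolynomial (Fin k ⊕ Fin k ⊕ Fin m) ℂ) ∣ g * h :=
      ⟨X (Sum.inr (Sum.inl j)), by rw [← MulMemClass.coe_mul, ← hgh, hf]⟩
    rcases (MvPolynomial.X_prime (R := ℂ)).dvd_or_dvd hdvd with hg | hh
    · exact Or.inr (key g h hgh hg)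
    · exact Or.inl (key h g (by rw [hgh, mul_comm]) hh)

theorem le_one_of_uniqueFactorizationMonoid_adjoin_quiverCycle {k m : ℕ}
    [UniqueFactorizationMonoid (Algebra.adjoin ℂ (Set.range (quiverCycle k m)))] :
    k ≤ 1 := by
  by_contra! hk
  let i : Fin k := ⟨0, by omega⟩
  let j : Fin k := ⟨1, hk⟩
  have hij : i ≠ j := by simp [i, j]
  let x (p q : Fin k) : Algebra.adjoin ℂ (Set.range (quiverCycle k m)) :=
    ⟨quiverCycle k m (Sum.inr (p, q)), Algebra.subset_adjoin ⟨_, rfl⟩⟩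
  have hx (p q : Fin k) : (x p q : MvPolynomial (Fin k ⊕ Fin k ⊕ Fin m) ℂ) =
      X (Sum.inl p) * X (Sum.inr (Sum.inl q)) := rfl
  have hprime : Prime (x i i) := (irreducible_quiverCycle i i (hx i i)).prime
  have hdvd : x i i ∣ x i j * x j i :=
    ⟨x j j, Subtype.ext (by simp only [MulMemClass.coe_mul, hx]; ring)⟩
  rcases hprime.dvd_or_dvd hdvd with h | h
  · have h' := map_dvd (Subalgebra.val _) h
    rw [Subalgebra.coe_val, hx, hx, mul_dvd_mul_iff_left (X_ne_zero _), X_dvd_X] at h'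
    simp_all
  · have h' := map_dvd (Subalgebra.val _) h
    rw [Subalgebra.coe_val, hx, hx, mul_dvd_mul_iff_right (X_ne_zero _), X_dvd_X] at h'
    simp_all

/-- In `R = ℂ[a_1,…,a_k, b_1,…,b_k, c_1,…,c_{2l}]`, the subalgebra `S` generated by the
`c_t` together with all products `a_i · b_j` is (isomorphic to) a polynomial ring
if and only if `k ≤ 1`. -/
theorem invariants_of_two_vertex_quiver_polynomial_iff
    (k l : ℕ)
    (S : Subalgebra ℂ (MvPolynomial (Fin k ⊕ Fin k ⊕ Fin (2 * l)) ℂ))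
    (hS : S = Algebra.adjoin ℂ
      (Set.range (fun t : Fin (2 * l) => (X (Sum.inr (Sum.inr t)) :
          MvPolynomial (Fin k ⊕ Fin k ⊕ Fin (2 * l)) ℂ)) ∪
       Set.range (fun ij : Fin k × Fin k =>
          (X (Sum.inl ij.1) * X (Sum.inr (Sum.inl ij.2)) :
          MvPolynomial (Fin k ⊕ Fin k ⊕ Fin (2 * l)) ℂ)))) :
    (∃ (σ : Type), Nonempty (S ≃ₐ[ℂ] MvPolynomial σ ℂ)) ↔ k ≤ 1 := by
  have hS' : S = Algebra.adjoin ℂ (Set.range (quiverCycle k (2 * l))) := by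
    rw [hS, quiverCycle, Set.Sum.elim_range]
  subst hS'
  constructor
  · rintro ⟨σ, ⟨e⟩⟩
    have := e.symm.toMulEquiv.uniqueFactorizationMonoid inferInstance
    exact le_one_of_uniqueFactorizationMonoid_adjoin_quiverCycle (m := 2 * l)
  · intro hk
    exact ⟨_, ⟨(algebraicIndependent_quiverCycle (2 * l) hk).aevalEquiv.symm⟩⟩
end

section
/- Let a ∈ ℕ^p and b ∈ ℕ^q be nonincreasing sequences of positive integers with Σ_i a_i = Σ_j b_j = n, and suppose α=(a;b) is the dimension vector of a θ-stable representation, i.e. n = 1 or (α is almost simple and the entries a_1,…,a_p,b_1,…,b_q are not all equal). Assume that for all i,j such that α − ε_{ij} is componentwise nonnegative and almost simple (with respect to its total n−1), one has a_i + b_j = n. Then either n = 1 (the trivial case α = (1;1)), or b_1 = b_2 = … = b_q, a_1 > a_2 and a_1 + b_1 = n, or symmetrically a_1 = a_2 = … = a_p, b_1 > b_2 and a_1 + b_1 = n. -/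
theorem add_le_sum_of_ne {ι : Type*} [Fintype ι] (f : ι → ℕ) {x y : ι} (hxy : x ≠ y) :
    f x + f y ≤ ∑ i, f i := by
  classical
  rw [← Finset.sum_pair hxy]
  exact Finset.sum_le_sum_of_subset (Finset.subset_univ _)

/-- If two distinct positive terms account for the whole sum, there are no other terms. -/
theorem eq_or_eq_of_sum_le_add {ι : Type*} [Fintype ι] {f : ι → ℕ} (hf : ∀ i, 0 < f i)
    {x y : ι} (hxy : x ≠ y) (h : ∑ i, f i ≤ f x + f y) (z : ι) : z = x ∨ z = y := by
  classical
  by_contra! hz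
  have hle : ∑ i ∈ {z, x, y}, f i ≤ ∑ i, f i :=
    Finset.sum_le_sum_of_subset (Finset.subset_univ _)
  rw [Finset.sum_insert (by simp [hz.1, hz.2]), Finset.sum_pair hxy] at hle
  have := hf z
  omega


/-- Lemma 3: if `α` is a θ-stable dimension vector all of whose almost-simple degenerations
`(α − ε_{ij}) ⊕ ε_{ij}` are smooth (i.e. `a_i + b_j = n`), then either `n = 1`, or all the
`b_j` are equal, `a_1 > a_2` and `a_1 + b_1 = n`, or symmetrically with the roles of `a`
and `b` exchanged. -/
theorem stable_dimension_vector_with_all_smooth_epsilon_degenerations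
    (p q n : ℕ) (hp : 0 < p) (hq : 0 < q)
    (a : Fin p → ℕ) (b : Fin q → ℕ)
    (hapos : ∀ i, 0 < a i) (hbpos : ∀ j, 0 < b j)
    (hamono : Antitone a) (hbmono : Antitone b)
    (ha : ∑ i, a i = n) (hb : ∑ j, b j = n)
    (hstable : n = 1 ∨
      ((∀ i j, a i + b j ≤ n) ∧ ¬ ∃ c, (∀ i, a i = c) ∧ (∀ j, b j = c)))
    (hdeg : ∀ (i : Fin p) (j : Fin q),
      (∀ (i' : Fin p) (j' : Fin q),
        (a i' - (if i' = i then 1 else 0)) + (b j' - (if j' = j then 1 else 0)) ≤ n - 1) →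
      a i + b j = n) :
    n = 1 ∨
    ((∀ j j' : Fin q, b j = b j') ∧
      (∀ i : Fin p, 0 < (i : ℕ) → a i < a ⟨0, hp⟩) ∧
      a ⟨0, hp⟩ + b ⟨0, hq⟩ = n) ∨
    ((∀ i i' : Fin p, a i = a i') ∧
      (∀ j : Fin q, 0 < (j : ℕ) → b j < b ⟨0, hq⟩) ∧
      a ⟨0, hp⟩ + b ⟨0, hq⟩ = n) := by
  rcases hstable with h1 | ⟨hle, hne⟩
  · exact Or.inl h1
  right
  have hA : ∀ i, a i ≤ a ⟨0, hp⟩ := fun i => hamono (Fin.mk_le_of_le_val (Nat.zero_le _))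
  have hB : ∀ j, b j ≤ b ⟨0, hq⟩ := fun j => hbmono (Fin.mk_le_of_le_val (Nat.zero_le _))
  have hsum : a ⟨0, hp⟩ + b ⟨0, hq⟩ = n := by
    by_contra h
    refine h (hdeg _ _ fun i j => ?_)
    have := hle ⟨0, hp⟩ ⟨0, hq⟩
    have := hA i
    have := hB j
    omega
  by_cases hastrict : ∀ i : Fin p, 0 < (i : ℕ) → a i < a ⟨0, hp⟩
  · have hbmax : ∀ j, b j = b ⟨0, hq⟩ := by
      intro j
      have := hdeg ⟨0, hp⟩ j fun i' j' => by
        have := hle i' j'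
        have := hapos i'
        have := hB j'
        by_cases hi : i' = ⟨0, hp⟩
        · rw [if_pos hi]
          omega
        · have := hastrict i' (Nat.pos_of_ne_zero fun h => hi (Fin.ext h))
          omega
      omega
    exact Or.inl ⟨fun j j' => (hbmax j).trans (hbmax j').symm, hastrict, hsum⟩
  by_cases hbstrict : ∀ j : Fin q, 0 < (j : ℕ) → b j < b ⟨0, hq⟩
  · have hamax : ∀ i, a i = a ⟨0, hp⟩ := by
      intro i
      have := hdeg i ⟨0, hq⟩ fun i' j' => by
        have := hle i' j'
        have := hbpos j'
        have := hA i'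
        by_cases hj : j' = ⟨0, hq⟩
        · rw [if_pos hj]
          omega
        · have := hbstrict j' (Nat.pos_of_ne_zero fun h => hj (Fin.ext h))
          omega
      omega
    exact Or.inr ⟨fun i i' => (hamax i).trans (hamax i').symm, hbstrict, hsum⟩
  -- Both maxima are attained twice, so `α = (m, m; m, m)` with `n = 2 * m`.
  push Not at hastrict hbstrict
  obtain ⟨i, hi, hai⟩ := hastrict
  obtain ⟨j, hj, hbj⟩ := hbstrict
  have hi0 : (⟨0, hp⟩ : Fin p) ≠ i := fun h => hi.ne (congrArg Fin.val h)
  have hj0 : (⟨0, hq⟩ : Fin q) ≠ j := fun h => hj.ne (congrArg Fin.val h)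
  have ha2 := add_le_sum_of_ne a hi0
  have hb2 := add_le_sum_of_ne b hj0
  have hAi := hA i
  have hBj := hB j
  refine absurd ⟨a ⟨0, hp⟩, fun z => ?_, fun z => ?_⟩ hne
  · rcases eq_or_eq_of_sum_le_add hapos hi0 (by omega) z with rfl | rfl <;> omega
  · rcases eq_or_eq_of_sum_le_add hbpos hj0 (by omega) z with rfl | rfl <;> omega
end

section
/- Fix m ≥ 1. Regarded as polynomials in the m(m+1) + (m+1) coordinate variables (the entries of the row vectors K_1,…,K_{m+1} ∈ ℂ^{1×m} and the scalars C_1,…,C_{m+1}), the m+1 functions T_1,…,T_{m+1}, where T_i(K,C) is the determinant of the (m+1)×(m+1) matrix whose j-th row for j ≠ i is (K_j, 0) and whose i-th row is (0,…,0, C_i), are algebraically independent over ℂ. -/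
/-- The semi-invariant `T_i` of the quiver `Q_m`: the determinant of the `(m+1)×(m+1)`
matrix whose `j`-th row, for `j ≠ i`, is `(K_j, 0)`, and whose `i`-th row is `(0,…,0,C_i)`. -/
noncomputable def quiverQmT (m : ℕ) (K : Fin (m + 1) → Fin m → ℂ) (C : Fin (m + 1) → ℂ)
    (i : Fin (m + 1)) : ℂ :=
  Matrix.det (Matrix.of fun j l : Fin (m + 1) =>
    if h : (l : ℕ) < m then (if j = i then 0 else K j ⟨l, h⟩)
    else (if j = i then C j else 0))

/-- Laplace expansion of `T_i` along its last column. -/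
theorem quiverQmT_eq (m : ℕ) (K : Fin (m + 1) → Fin m → ℂ) (C : Fin (m + 1) → ℂ)
    (i : Fin (m + 1)) :
    quiverQmT m K C i =
      (-1) ^ ((i : ℕ) + m) * C i * (Matrix.of fun j l => K (i.succAbove j) l).det := by
  rw [quiverQmT, Matrix.det_succ_column _ (Fin.last m), Finset.sum_eq_single i]
  · simp only [Matrix.of_apply, Fin.val_last, lt_irrefl, dite_false, if_true]
    congr 2
    ext j l
    simp [Fin.succAbove_ne]
  · intro j _ hj
    simp [hj]
  · simp

/-- For `K` with nonzero maximal minors, `C` can be chosen to realize any values of the `T_i`. -/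
theorem exists_quiverQmT_eq (m : ℕ) (t : Fin (m + 1) → ℂ) :
    ∃ V : (Fin (m + 1) → Fin m → ℂ) × (Fin (m + 1) → ℂ), ∀ i, quiverQmT m V.1 V.2 i = t i := by
  let K : Fin (m + 1) → Fin m → ℂ := fun j l => (j : ℂ) ^ (l : ℕ)
  have hK (i : Fin (m + 1)) : (Matrix.of fun j l => K (i.succAbove j) l).det ≠ 0 := by
    refine Matrix.det_vandermonde_ne_zero_iff (v := fun j => ((i.succAbove j : ℕ) : ℂ)).2 ?_
    exact Nat.cast_injective.comp (Fin.val_injective.comp Fin.succAbove_right_injective)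
  refine ⟨(K, fun i => t i /
    ((-1) ^ ((i : ℕ) + m) * (Matrix.of fun j l => K (i.succAbove j) l).det)), fun i => ?_⟩
  have h := hK i
  rw [quiverQmT_eq]
  field_simp

/-- The `m+1` polynomial functions `T_1, …, T_{m+1}` on the representation space of `Q_m`
are algebraically independent over `ℂ`. -/
theorem quiverQmT_algebraicIndependent (m : ℕ) (hm : 1 ≤ m) :
    AlgebraicIndependent ℂ
      (fun (i : Fin (m + 1))
        (V : (Fin (m + 1) → Fin m → ℂ) × (Fin (m + 1) → ℂ)) =>
          quiverQmT m V.1 V.2 i) := by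
  rw [algebraicIndependent_iff]
  intro p hp
  refine MvPolynomial.funext fun t => ?_
  obtain ⟨V, hV⟩ := exists_quiverQmT_eq m t
  have h := congrArg (Pi.evalAlgHom ℂ (fun _ => ℂ) V) hp
  rw [MvPolynomial.comp_aeval_apply] at h
  simpa [hV, MvPolynomial.aeval_eq_eval] using h
end

section
/- Fix m ≥ 1. Let f be a polynomial function of (K_1,…,K_{m+1}, C_1,…,C_{m+1}) ∈ (ℂ^{1×m})^{m+1} × ℂ^{m+1} such that for some d ∈ ℕ and all g ∈ GL_m(ℂ), λ ∈ ℂ^×, μ_1,…,μ_{m+1} ∈ ℂ^×: f((μ_j K_j g^{-1})_j, (μ_j C_j λ^{-1})_j) = ((det g)·λ)^{-d} (∏_j μ_j)^d · f(K,C). Then f belongs to the ℂ-subalgebra generated by T_1,…,T_{m+1}, where T_i(K,C) is the determinant of the (m+1)×(m+1) matrix whose j-th row for j ≠ i is (K_j, 0) and whose i-th row is (0,…,0, C_i). Hence the ring of semi-invariants of Q_m at dimension vector (m,1;1,…,1) is the polynomial ring ℂ[T_1,…,T_{m+1}] in m+1 variables (so the moduli space of θ-semistable representations is ℙ^m). 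-/
/-- The maximal minor of `K` omitting row `i`, with the sign making it the cofactor of the `i`-th
entry of an extra last column. -/
def signedMinor {R : Type*} [CommRing R] {m : ℕ} (K : Fin (m + 1) → Fin m → R)
    (i : Fin (m + 1)) : R :=
  (-1) ^ ((i : ℕ) + m) * Matrix.det (Matrix.of fun k l => K (i.succAbove k) l)

theorem RingHom.map_signedMinor {R S : Type*} [CommRing R] [CommRing S] (φ : R →+* S) {m : ℕ}
    (K : Fin (m + 1) → Fin m → R) (i : Fin (m + 1)) :
    φ (signedMinor K i) = signedMinor (fun j l => φ (K j l)) i := by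
  simp only [signedMinor, map_mul, map_pow, map_neg, map_one, RingHom.map_det]
  rfl

/-- Cofactor expansion along an adjoined last column. -/
theorem det_snoc_column {R : Type*} [CommRing R] {m : ℕ} (K : Fin (m + 1) → Fin m → R)
    (c : Fin (m + 1) → R) :
    Matrix.det (Matrix.of fun j : Fin (m + 1) => (Fin.snoc (K j) (c j) : Fin (m + 1) → R)) =
      ∑ j, signedMinor K j * c j := by
  rw [Matrix.det_succ_column _ (Fin.last m)]
  refine Finset.sum_congr rfl fun j _ => ?_
  have hsub : (Matrix.of fun j : Fin (m + 1) =>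
      (Fin.snoc (K j) (c j) : Fin (m + 1) → R)).submatrix j.succAbove (Fin.last m).succAbove =
      Matrix.of fun k l => K (j.succAbove k) l := by
    ext k l
    simp [Fin.succAbove_last]
  rw [hsub]
  simp only [signedMinor, Matrix.of_apply, Fin.snoc_last, Fin.val_last]
  ring

/-- Cramer's relation among the rows of an `(m+1) × m` matrix. -/
theorem sum_signedMinor_mul_eq_zero {R : Type*} [CommRing R] {m : ℕ}
    (K : Fin (m + 1) → Fin m → R) (l : Fin m) : ∑ j, signedMinor K j * K j l = 0 := by
  rw [← det_snoc_column K fun j => K j l]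
  refine Matrix.det_zero_of_column_eq (Fin.castSucc_lt_last l).ne fun j => ?_
  simp

theorem quiverQmT_eq_s10 {m : ℕ} (K : Fin (m + 1) → Fin m → ℂ) (C : Fin (m + 1) → ℂ)
    (i : Fin (m + 1)) : quiverQmT m K C i = signedMinor K i * C i := by
  have hmat : quiverQmT m K C i = Matrix.det (Matrix.of fun j : Fin (m + 1) =>
      (Fin.snoc (if j = i then 0 else K j) (if j = i then C j else 0) : Fin (m + 1) → ℂ)) := by
    unfold quiverQmT
    congr 1
    ext j l
    refine Fin.lastCases ?_ (fun l => ?_) l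
    · simp
    · by_cases h : j = i <;> simp [h]
  rw [hmat, det_snoc_column, Finset.sum_eq_single i]
  · have hrow : ∀ k, i.succAbove k ≠ i := fun k => Fin.succAbove_ne i k
    simp [signedMinor, hrow]
  · intro j _ hj
    simp [hj]
  · simp

/-- The base point: the standard basis followed by `(-1, …, -1)`, whose rows sum to zero. -/
def baseRows (R : Type*) [CommRing R] (m : ℕ) : Fin (m + 1) → Fin m → R :=
  Fin.snoc (α := fun _ => Fin m → R) (fun k => Pi.single k 1) (fun _ => -1)

/-- The leading rows of `K`, rescaled by the signed minors. -/
def scaledRows {R : Type*} [CommRing R] {m : ℕ} (K : Fin (m + 1) → Fin m → R) :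
    Matrix (Fin m) (Fin m) R :=
  Matrix.of fun k l => signedMinor K k.castSucc * K k.castSucc l

theorem det_scaledRows {R : Type*} [CommRing R] {m : ℕ} (K : Fin (m + 1) → Fin m → R) :
    (scaledRows K).det = ∏ j, signedMinor K j := by
  rw [Fin.prod_univ_castSucc]
  have hlast : signedMinor K (Fin.last m) =
      Matrix.det (Matrix.of fun k : Fin m => K k.castSucc) := by
    simp only [signedMinor, Fin.val_last, Fin.succAbove_last, ← two_mul, pow_mul]
    simp
  rw [hlast, ← Matrix.det_mul_column]
  rfl

theorem smul_eq_vecMul_scaledRows {R : Type*} [CommRing R] {m : ℕ}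
    (K : Fin (m + 1) → Fin m → R) (j : Fin (m + 1)) :
    signedMinor K j • K j = Matrix.vecMul (baseRows R m j) (scaledRows K) := by
  refine Fin.lastCases ?_ (fun k => ?_) j
  · ext l
    have h := sum_signedMinor_mul_eq_zero K l
    rw [Fin.sum_univ_castSucc] at h
    simp only [baseRows, Fin.snoc_last, Matrix.vecMul, dotProduct, scaledRows, Matrix.of_apply,
      neg_one_mul, Finset.sum_neg_distrib, Pi.smul_apply, smul_eq_mul]
    linear_combination h
  · ext l
    simp [baseRows, scaledRows]

/-- On the locus where all maximal minors are nonzero, a semi-invariant is determined by its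
values at the base point. -/
theorem semiinvariant_eq_of_signedMinor_ne_zero {m : ℕ}
    {f : (Fin (m + 1) → Fin m → ℂ) × (Fin (m + 1) → ℂ) → ℂ} {d : ℕ}
    (hsemi : ∀ (g : GL (Fin m) ℂ) (lam : ℂˣ) (μ : Fin (m + 1) → ℂˣ)
      (K : Fin (m + 1) → Fin m → ℂ) (C : Fin (m + 1) → ℂ),
      f (fun j => (μ j : ℂ) • Matrix.vecMul (K j) (↑g⁻¹ : Matrix (Fin m) (Fin m) ℂ),
         fun j => (μ j : ℂ) * C j * ((lam : ℂ))⁻¹)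
        = (((↑g : Matrix (Fin m) (Fin m) ℂ).det * (lam : ℂ))⁻¹ * ∏ j, (μ j : ℂ)) ^ d
            * f (K, C))
    {K : Fin (m + 1) → Fin m → ℂ} (hK : ∀ j, signedMinor K j ≠ 0) (C : Fin (m + 1) → ℂ) :
    f (K, C) = f (baseRows ℂ m, fun j => signedMinor K j * C j) := by
  have hprod : ∏ j, signedMinor K j ≠ 0 := Finset.prod_ne_zero_iff.2 fun j _ => hK j
  have hdet : (scaledRows K).det ≠ 0 := by rwa [det_scaledRows]
  let g := Matrix.GeneralLinearGroup.mkOfDetNeZero (scaledRows K) hdet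
  have hg : (g : Matrix (Fin m) (Fin m) ℂ) = scaledRows K := rfl
  have h := hsemi g 1 (fun j => Units.mk0 _ (hK j)) K C
  have hrows : (fun j => signedMinor K j •
      Matrix.vecMul (K j) (↑g⁻¹ : Matrix (Fin m) (Fin m) ℂ)) = baseRows ℂ m := by
    funext j
    rw [← Matrix.smul_vecMul, smul_eq_vecMul_scaledRows, Matrix.vecMul_vecMul, ← hg,
      ← Units.val_mul, mul_inv_cancel, Units.val_one, Matrix.vecMul_one]
  simp only [Units.val_mk0, hrows, hg, det_scaledRows, Units.val_one, mul_one, inv_one,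
    inv_mul_cancel₀ hprod, one_pow, one_mul] at h
  exact h.symm

/-- The signed minors of the generic matrix are nonzero polynomials. -/
theorem signedMinor_X_ne_zero {m : ℕ} (i : Fin (m + 1)) :
    signedMinor (fun j l => (MvPolynomial.X (Sum.inl (j, l)) :
      MvPolynomial ((Fin (m + 1) × Fin m) ⊕ Fin (m + 1)) ℂ)) i ≠ 0 := by
  intro h
  have h' := congrArg (MvPolynomial.eval (Sum.elim (fun kl => (i.insertNth (α := fun _ =>
    Fin m → ℂ) 0 fun k => Pi.single k 1) kl.1 kl.2) (fun _ => 0))) h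
  rw [RingHom.map_signedMinor] at h'
  simp only [signedMinor, MvPolynomial.eval_X, Sum.elim_inl, Fin.insertNth_apply_succAbove,
    map_zero] at h'
  have hone : (Matrix.of fun k l => (Pi.single k 1 : Fin m → ℂ) l) = 1 := by
    ext k l
    simp [Matrix.one_apply, Pi.single_apply, eq_comm]
  rw [hone] at h'
  simp at h'

/-- A polynomial semi-invariant is its restriction to the base point, evaluated at the `T_i`. -/
theorem semiinvariant_eval_eq {m : ℕ}
    {f : (Fin (m + 1) → Fin m → ℂ) × (Fin (m + 1) → ℂ) → ℂ}
    {P : MvPolynomial ((Fin (m + 1) × Fin m) ⊕ Fin (m + 1)) ℂ}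
    (hP : ∀ V, f V = MvPolynomial.eval (Sum.elim (fun kl => V.1 kl.1 kl.2) V.2) P)
    (hgen : ∀ K C, (∀ j, signedMinor K j ≠ 0) →
      f (K, C) = f (baseRows ℂ m, fun j => signedMinor K j * C j))
    (K : Fin (m + 1) → Fin m → ℂ) (C : Fin (m + 1) → ℂ) :
    f (K, C) = f (baseRows ℂ m, fun j => signedMinor K j * C j) := by
  let σ := (Fin (m + 1) × Fin m) ⊕ Fin (m + 1)
  let S : Fin (m + 1) → MvPolynomial σ ℂ :=
    signedMinor fun j l => MvPolynomial.X (Sum.inl (j, l))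
  let Q : MvPolynomial σ ℂ := MvPolynomial.bind₁
    (Sum.elim (fun kl => MvPolynomial.C (baseRows ℂ m kl.1 kl.2))
      fun j => S j * MvPolynomial.X (Sum.inr j)) P
  have hS : ∀ x j, MvPolynomial.eval x (S j) = signedMinor (fun j l => x (Sum.inl (j, l))) j := by
    intro x j
    simp [S, RingHom.map_signedMinor]
  have hQ : ∀ x, MvPolynomial.eval x Q = f (baseRows ℂ m,
      fun j => signedMinor (fun j l => x (Sum.inl (j, l))) j * x (Sum.inr j)) := by
    intro x
    rw [hP, ← MvPolynomial.coe_aeval_eq_eval]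
    simp only [Q, RingHom.coe_coe, MvPolynomial.aeval_bind₁]
    rw [← MvPolynomial.coe_aeval_eq_eval, RingHom.coe_coe]
    congr 2
    funext s
    rcases s with kl | j
    · simp
    · simp [← hS]
  have hPx : ∀ x, MvPolynomial.eval x P =
      f (fun j l => x (Sum.inl (j, l)), fun j => x (Sum.inr j)) := by
    intro x
    rw [hP]
    congr 2
    funext s
    rcases s with kl | j <;> rfl
  have hmul : (P - Q) * ∏ j, S j = 0 := by
    refine MvPolynomial.funext fun x => ?_
    rw [map_mul, map_prod, map_sub, map_zero, hQ, hPx]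
    by_cases h : ∀ j, signedMinor (fun j l => x (Sum.inl (j, l))) j ≠ 0
    · rw [hgen _ _ h, sub_self, zero_mul]
    · push Not at h
      obtain ⟨j, hj⟩ := h
      rw [Finset.prod_eq_zero (Finset.mem_univ j) (by rw [hS, hj]), mul_zero]
  have hPQ : P = Q := sub_eq_zero.1 <| (mul_eq_zero.1 hmul).resolve_right <|
    Finset.prod_ne_zero_iff.2 fun j _ => signedMinor_X_ne_zero j
  have h := hQ (Sum.elim (fun kl => K kl.1 kl.2) C)
  rw [← hPQ, hPx] at h
  exact h

/-- Every semi-invariant polynomial function on the representation space of `Q_m` (of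
weight `χ_θ^d` for some `d`) lies in the `ℂ`-subalgebra generated by `T_1, …, T_{m+1}`:
the ring of semi-invariants is the polynomial ring `ℂ[T_1,…,T_{m+1}]`. -/
theorem quiverQm_semiinvariants_generated_by_T
    (m : ℕ) (hm : 1 ≤ m)
    (f : (Fin (m + 1) → Fin m → ℂ) × (Fin (m + 1) → ℂ) → ℂ)
    (hpoly : ∃ P : MvPolynomial ((Fin (m + 1) × Fin m) ⊕ Fin (m + 1)) ℂ,
      ∀ V, f V = MvPolynomial.eval (Sum.elim (fun kl => V.1 kl.1 kl.2) V.2) P)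
    (d : ℕ)
    (hsemi : ∀ (g : GL (Fin m) ℂ) (lam : ℂˣ) (μ : Fin (m + 1) → ℂˣ)
      (K : Fin (m + 1) → Fin m → ℂ) (C : Fin (m + 1) → ℂ),
      f (fun j => (μ j : ℂ) • Matrix.vecMul (K j) (↑g⁻¹ : Matrix (Fin m) (Fin m) ℂ),
         fun j => (μ j : ℂ) * C j * ((lam : ℂ))⁻¹)
        = (((↑g : Matrix (Fin m) (Fin m) ℂ).det * (lam : ℂ))⁻¹ * ∏ j, (μ j : ℂ)) ^ d
            * f (K, C)) :
    f ∈ Algebra.adjoin ℂ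
      (Set.range (fun (i : Fin (m + 1))
        (V : (Fin (m + 1) → Fin m → ℂ) × (Fin (m + 1) → ℂ)) =>
          quiverQmT m V.1 V.2 i)) := by
  obtain ⟨P, hP⟩ := hpoly
  have hf : f = MvPolynomial.aeval (Sum.elim
      (fun kl => algebraMap ℂ _ (baseRows ℂ m kl.1 kl.2))
      (fun i (V : (Fin (m + 1) → Fin m → ℂ) × (Fin (m + 1) → ℂ)) => quiverQmT m V.1 V.2 i)) P := by
    funext V
    refine Eq.trans ?_ (Pi.evalAlgHom_apply ℂ (fun _ => ℂ) V _)
    rw [← AlgHom.comp_apply, MvPolynomial.comp_aeval, semiinvariant_eval_eq hP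
      (fun K C hK => semiinvariant_eq_of_signedMinor_ne_zero hsemi hK C) V.1 V.2, hP,
      ← MvPolynomial.coe_aeval_eq_eval, RingHom.coe_coe]
    congr 2
    funext s
    rcases s with kl | i
    · simp
    · simp [quiverQmT_eq_s10]
  rw [hf]
  refine (Algebra.adjoin_range_eq_range_aeval ℂ _).symm.le.trans (Algebra.adjoin_le ?_) ⟨P, rfl⟩
  rintro _ ⟨kl | i, rfl⟩
  · exact Subalgebra.algebraMap_mem _ _
  · exact Algebra.subset_adjoin ⟨i, rfl⟩
end

section
/- Consider tuples (A, B, C_1, C_2, D_1, D_2) with A, B ∈ Mat_2(ℂ) and C_1, C_2, D_1, D_2 ∈ ℂ^{1×2}. Define four polynomial functions by the 4×4 determinants T_1 = det[[A, 0],[0, D_1],[0, D_2]], T_2 = det[[0, B],[C_1, 0],[C_2, 0]], T_3 = det[[A, B],[C_1, 0],[0, D_2]], T_4 = det[[A, B],[0, D_1],[C_2, 0]], where in each matrix the first two columns are the V_1-columns and the last two columns are the V_2-columns, A and B each occupy two rows, and each C_i, D_i occupies one row. Then T_1, T_2, T_3, T_4 are algebraically independent over ℂ. -/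
/-- The representation space of the quiver `Q_III` at dimension vector `(2,2;2,1,1)`:
a tuple `(A, B, C₁, C₂, D₁, D₂)` of two `2×2` matrices and four row vectors. -/
abbrev QIIIRep : Type :=
  Matrix (Fin 2) (Fin 2) ℂ × Matrix (Fin 2) (Fin 2) ℂ ×
    (Fin 2 → ℂ) × (Fin 2 → ℂ) × (Fin 2 → ℂ) × (Fin 2 → ℂ)

/-- `T₁ = det [[A,0],[0,D₁],[0,D₂]]`. -/
noncomputable def QIIIT1 : QIIIRep → ℂ := fun ⟨A, _, _, _, D1, D2⟩ =>
  Matrix.det !![A 0 0, A 0 1, 0, 0;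
                A 1 0, A 1 1, 0, 0;
                0, 0, D1 0, D1 1;
                0, 0, D2 0, D2 1]

/-- `T₂ = det [[0,B],[C₁,0],[C₂,0]]`. -/
noncomputable def QIIIT2 : QIIIRep → ℂ := fun ⟨_, B, C1, C2, _, _⟩ =>
  Matrix.det !![0, 0, B 0 0, B 0 1;
                0, 0, B 1 0, B 1 1;
                C1 0, C1 1, 0, 0;
                C2 0, C2 1, 0, 0]

/-- `T₃ = det [[A,B],[C₁,0],[0,D₂]]`. -/
noncomputable def QIIIT3 : QIIIRep → ℂ := fun ⟨A, B, C1, _, _, D2⟩ =>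
  Matrix.det !![A 0 0, A 0 1, B 0 0, B 0 1;
                A 1 0, A 1 1, B 1 0, B 1 1;
                C1 0, C1 1, 0, 0;
                0, 0, D2 0, D2 1]

/-- `T₄ = det [[A,B],[0,D₁],[C₂,0]]`. -/
noncomputable def QIIIT4 : QIIIRep → ℂ := fun ⟨A, B, _, C2, D1, _⟩ =>
  Matrix.det !![A 0 0, A 0 1, B 0 0, B 0 1;
                A 1 0, A 1 1, B 1 0, B 1 1;
                0, 0, D1 0, D1 1;
                C2 0, C2 1, 0, 0]

/-- A point of the representation space at which `(T₁, T₂, T₃, T₄)` takes the value `t`. -/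
def QIIISection (t : Fin 4 → ℂ) : QIIIRep :=
  (1, 1, ![1, 0], ![t 3, t 1], ![0, 1], ![-t 0, -t 2])

/-- `QIIISection` is a section of the map `(T₁, T₂, T₃, T₄)` to affine four-space. -/
theorem QIIIT_apply_section (t : Fin 4 → ℂ) (i : Fin 4) :
    (![QIIIT1, QIIIT2, QIIIT3, QIIIT4] : Fin 4 → (QIIIRep → ℂ)) i (QIIISection t) = t i := by
  fin_cases i <;>
    simp [QIIISection, QIIIT1, QIIIT2, QIIIT3, QIIIT4, Matrix.det_succ_row_zero,
      Fin.sum_univ_succ, Fin.succAbove]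

/-- The four polynomial functions `T₁, T₂, T₃, T₄` on the representation space of `Q_III`
are algebraically independent over `ℂ`. -/
theorem QIIIT_algebraicIndependent :
    AlgebraicIndependent ℂ (![QIIIT1, QIIIT2, QIIIT3, QIIIT4] : Fin 4 → (QIIIRep → ℂ)) := by
  refine algebraicIndependent_iff.mpr fun p hp => MvPolynomial.funext fun t => ?_
  have h := congrArg (Pi.evalAlgHom ℂ (fun _ : QIIIRep => ℂ) (QIIISection t)) hp
  rw [← AlgHom.comp_apply, MvPolynomial.comp_aeval] at h
  simpa only [Pi.evalAlgHom_apply, QIIIT_apply_section, MvPolynomial.aeval_eq_eval,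
    Pi.zero_apply, map_zero] using h
end

section
/- Consider tuples (A, B, C_1, C_2, D_1, D_2) with A, B ∈ Mat_2(ℂ) and C_1, C_2, D_1, D_2 ∈ ℂ^{1×2}, and the four determinants T_1 = det[[A, 0],[0, D_1],[0, D_2]], T_2 = det[[0, B],[C_1, 0],[C_2, 0]], T_3 = det[[A, B],[C_1, 0],[0, D_2]], T_4 = det[[A, B],[0, D_1],[C_2, 0]]. Let f be a polynomial function of (A,B,C_1,C_2,D_1,D_2) such that for some d ∈ ℕ and all g_1, g_2, h ∈ GL_2(ℂ) and ν_1, ν_2 ∈ ℂ^×: f(hAg_1^{-1}, hBg_2^{-1}, ν_1 C_1 g_1^{-1}, ν_2 C_2 g_1^{-1}, ν_1 D_1 g_2^{-1}, ν_2 D_2 g_2^{-1}) = ((det g_1 · det g_2)^{-1} · det h · ν_1 ν_2)^d · f(A,B,C_1,C_2,D_1,D_2). Then f belongs to the ℂ-subalgebra generated by T_1, T_2, T_3, T_4. Hence the ring of semi-invariants of Q_III at dimension vector (2,2;2,1,1) is the polynomial ring ℂ[T_1,…,T_4] in 4 variables (so the moduli space of θ-semistable representations is ℙ^3). -/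
open Matrix in
/-- A representation with `A`, `B` and the rows `C₂A⁻¹`, `D₂B⁻¹` in general position is equivalent to
one with `A = B = 1`, `C₂ = e₀`, `D₂ = e₁` whose remaining entries are the `Tᵢ` up to sign. -/
theorem QIIIRep.semiinvariant_eq_normalForm
    (f : QIIIRep → ℂ) (d : ℕ)
    (hsemi : ∀ (g1 g2 h : GL (Fin 2) ℂ) (ν1 ν2 : ℂˣ)
      (A B : Matrix (Fin 2) (Fin 2) ℂ) (C1 C2 D1 D2 : Fin 2 → ℂ),
      f ((↑h : Matrix (Fin 2) (Fin 2) ℂ) * A * (↑(g1⁻¹) : Matrix (Fin 2) (Fin 2) ℂ),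
         (↑h : Matrix (Fin 2) (Fin 2) ℂ) * B * (↑(g2⁻¹) : Matrix (Fin 2) (Fin 2) ℂ),
         (ν1 : ℂ) • Matrix.vecMul C1 (↑(g1⁻¹) : Matrix (Fin 2) (Fin 2) ℂ),
         (ν2 : ℂ) • Matrix.vecMul C2 (↑(g1⁻¹) : Matrix (Fin 2) (Fin 2) ℂ),
         (ν1 : ℂ) • Matrix.vecMul D1 (↑(g2⁻¹) : Matrix (Fin 2) (Fin 2) ℂ),
         (ν2 : ℂ) • Matrix.vecMul D2 (↑(g2⁻¹) : Matrix (Fin 2) (Fin 2) ℂ))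
        = ((((↑g1 : Matrix (Fin 2) (Fin 2) ℂ).det *
              (↑g2 : Matrix (Fin 2) (Fin 2) ℂ).det)⁻¹ *
            (↑h : Matrix (Fin 2) (Fin 2) ℂ).det * (ν1 : ℂ) * (ν2 : ℂ)) ^ d)
            * f (A, B, C1, C2, D1, D2))
    (A B : Matrix (Fin 2) (Fin 2) ℂ) (C1 C2 D1 D2 : Fin 2 → ℂ)
    (hA : A.det ≠ 0) (hB : B.det ≠ 0)
    (hE : (Matrix.of ![C2 ᵥ* A.adjugate, D2 ᵥ* B.adjugate]).det ≠ 0) :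
    f (A, B, C1, C2, D1, D2) =
      f (1, 1, ![-QIIIT3 (A, B, C1, C2, D1, D2), -QIIIT2 (A, B, C1, C2, D1, D2)], ![1, 0],
        ![QIIIT1 (A, B, C1, C2, D1, D2), QIIIT4 (A, B, C1, C2, D1, D2)], ![0, 1]) := by
  set H : Matrix (Fin 2) (Fin 2) ℂ :=
    Matrix.of ![B.det • C2 ᵥ* A.adjugate, A.det • D2 ᵥ* B.adjugate] with hH
  have hHdet : H.det =
      A.det * B.det * (Matrix.of ![C2 ᵥ* A.adjugate, D2 ᵥ* B.adjugate]).det := by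
    simp [hH, Matrix.det_fin_two]
    ring
  have hHne : H.det ≠ 0 := by rw [hHdet]; exact mul_ne_zero (mul_ne_zero hA hB) hE
  set h : GL (Fin 2) ℂ := Matrix.GeneralLinearGroup.mkOfDetNeZero H hHne
  set a : GL (Fin 2) ℂ := Matrix.GeneralLinearGroup.mkOfDetNeZero A hA
  set b : GL (Fin 2) ℂ := Matrix.GeneralLinearGroup.mkOfDetNeZero B hB
  have coe_h : (h : Matrix (Fin 2) (Fin 2) ℂ) = H := rfl
  have coe_a : (a : Matrix (Fin 2) (Fin 2) ℂ) = A := rfl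
  have coe_b : (b : Matrix (Fin 2) (Fin 2) ℂ) = B := rfl
  have mul_cancel (g : GL (Fin 2) ℂ) :
      (h : Matrix (Fin 2) (Fin 2) ℂ) * g * ((h * g)⁻¹ : GL (Fin 2) ℂ) = 1 := by
    rw [← Units.val_mul, ← Units.val_mul, mul_inv_cancel, Units.val_one]
  have vecMul_inv (g : GL (Fin 2) ℂ) (c : ℂ) (v w : Fin 2 → ℂ)
      (hvw : c • v = w ᵥ* (g : Matrix (Fin 2) (Fin 2) ℂ)) :
      c • (v ᵥ* ((g⁻¹ : GL (Fin 2) ℂ) : Matrix (Fin 2) (Fin 2) ℂ)) = w := by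
    rw [← Matrix.smul_vecMul, hvw, Matrix.vecMul_vecMul, ← Units.val_mul, mul_inv_cancel,
      Units.val_one, Matrix.vecMul_one]
  have key := hsemi (h * a) (h * b) h (Units.mk0 H.det hHne)
    (Units.mk0 (A.det * B.det) (mul_ne_zero hA hB)) A B C1 C2 D1 D2
  have factor : ((((h * a : GL (Fin 2) ℂ) : Matrix (Fin 2) (Fin 2) ℂ).det *
      ((h * b : GL (Fin 2) ℂ) : Matrix (Fin 2) (Fin 2) ℂ).det)⁻¹ *
      (h : Matrix (Fin 2) (Fin 2) ℂ).det * H.det * (A.det * B.det)) = 1 := by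
    rw [Units.val_mul, Units.val_mul, coe_h, coe_a, coe_b, Matrix.det_mul, Matrix.det_mul]
    field_simp
  rw [Units.val_mk0, Units.val_mk0, factor, one_pow, one_mul] at key
  rw [← key]
  congr 1
  refine Prod.ext (mul_cancel a) (Prod.ext (mul_cancel b) (Prod.ext ?_ (Prod.ext ?_
    (Prod.ext ?_ ?_)))) <;>
  · refine vecMul_inv _ _ _ _ ?_
    rw [Units.val_mul, coe_h]
    simp only [coe_a, coe_b, hH]
    ext i
    fin_cases i <;>
    · simp [QIIIT1, QIIIT2, QIIIT3, QIIIT4, Matrix.det_succ_row_zero, Matrix.vecMul, dotProduct,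
        Matrix.mul_apply, Fin.sum_univ_succ, Matrix.adjugate_fin_two, Fin.succAbove,
        Matrix.vecHead, Matrix.vecTail]
      ring

/-- The index type of the coordinates of `QIIIRep`. -/
abbrev QIIIRep.Coord : Type :=
  (Fin 2 × Fin 2) ⊕ (Fin 2 × Fin 2) ⊕ Fin 2 ⊕ Fin 2 ⊕ Fin 2 ⊕ Fin 2

/-- The coordinate vector of a representation. -/
def QIIIRep.coords (V : QIIIRep) : QIIIRep.Coord → ℂ :=
  Sum.elim (fun kl => V.1 kl.1 kl.2)
    (Sum.elim (fun kl => V.2.1 kl.1 kl.2)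
      (Sum.elim V.2.2.1 (Sum.elim V.2.2.2.1 (Sum.elim V.2.2.2.2.1 V.2.2.2.2.2))))

theorem QIIIRep.coords_surjective : Function.Surjective QIIIRep.coords := by
  intro x
  refine ⟨(fun k l => x (.inl (k, l)), fun k l => x (.inr (.inl (k, l))),
    fun i => x (.inr (.inr (.inl i))), fun i => x (.inr (.inr (.inr (.inl i)))),
    fun i => x (.inr (.inr (.inr (.inr (.inl i))))),
    fun i => x (.inr (.inr (.inr (.inr (.inr i)))))), ?_⟩
  ext (_ | _ | _ | _ | _ | _) <;> rfl

/-- The algebra homomorphism sending a polynomial to the function it defines on `QIIIRep`. -/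
noncomputable def QIIIRep.toFun : MvPolynomial QIIIRep.Coord ℂ →ₐ[ℂ] (QIIIRep → ℂ) :=
  MvPolynomial.aeval fun i V => V.coords i

theorem MvPolynomial.aeval_pi_apply {σ ι R : Type*} [CommSemiring R] (g : σ → ι → R)
    (P : MvPolynomial σ R) (x : ι) :
    MvPolynomial.aeval g P x = MvPolynomial.eval (fun i => g i x) P := by
  have := MvPolynomial.comp_aeval_apply (R := R) (φ := Pi.evalAlgHom R (fun _ : ι => R) x) g P
  simpa [MvPolynomial.aeval_eq_eval] using this

theorem QIIIRep.toFun_injective : Function.Injective QIIIRep.toFun := by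
  intro P Q hPQ
  refine MvPolynomial.funext fun x => ?_
  obtain ⟨V, rfl⟩ := QIIIRep.coords_surjective x
  simpa [QIIIRep.toFun, MvPolynomial.aeval_pi_apply] using congrFun hPQ V

theorem QIIIRep.coord_mem_range (i : QIIIRep.Coord) :
    (fun V : QIIIRep => V.coords i) ∈ QIIIRep.toFun.range :=
  ⟨MvPolynomial.X i, by simp [QIIIRep.toFun]⟩

theorem QIIIRep.det_mem_range {n : ℕ} {M : QIIIRep → Matrix (Fin n) (Fin n) ℂ}
    (hM : ∀ i j, (fun V => M V i j) ∈ QIIIRep.toFun.range) :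
    (fun V => (M V).det) ∈ QIIIRep.toFun.range := by
  have : (fun V => (M V).det) =
      ∑ σ : Equiv.Perm (Fin n), Equiv.Perm.sign σ • ∏ i, fun V => M V (σ i) i := by
    ext V
    simp [Matrix.det_apply, Finset.sum_apply, Finset.prod_apply]
  rw [this]
  exact sum_mem fun σ _ => zsmul_mem (prod_mem fun i _ => hM _ _) _

open Matrix in
theorem QIIIRep.vecMul_adjugate_mem_range {v : QIIIRep → Fin 2 → ℂ}
    {M : QIIIRep → Matrix (Fin 2) (Fin 2) ℂ}
    (hv : ∀ i, (fun V => v V i) ∈ QIIIRep.toFun.range)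
    (hM : ∀ i j, (fun V => M V i j) ∈ QIIIRep.toFun.range) (j : Fin 2) :
    (fun V => (v V ᵥ* (M V).adjugate) j) ∈ QIIIRep.toFun.range := by
  have : (fun V => (v V ᵥ* (M V).adjugate) j) =
      ∑ i, (fun V => v V i) * fun V => (M V).adjugate i j := by
    ext V
    simp [Matrix.vecMul, dotProduct]
  rw [this]
  refine sum_mem fun i _ => mul_mem (hv i) ?_
  simp only [Matrix.adjugate_fin_two]
  fin_cases i <;> fin_cases j
  exacts [hM 1 1, neg_mem (hM 0 1), neg_mem (hM 1 0), hM 0 0]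

theorem QIIIRep.T_mem_range :
    ({QIIIT1, QIIIT2, QIIIT3, QIIIT4} : Set (QIIIRep → ℂ)) ⊆ QIIIRep.toFun.range := by
  have hA (k l) := QIIIRep.coord_mem_range (.inl (k, l))
  have hB (k l) := QIIIRep.coord_mem_range (.inr (.inl (k, l)))
  have hC1 (i) := QIIIRep.coord_mem_range (.inr (.inr (.inl i)))
  have hC2 (i) := QIIIRep.coord_mem_range (.inr (.inr (.inr (.inl i))))
  have hD1 (i) := QIIIRep.coord_mem_range (.inr (.inr (.inr (.inr (.inl i)))))
  have hD2 (i) := QIIIRep.coord_mem_range (.inr (.inr (.inr (.inr (.inr i)))))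
  have hz : (fun _ : QIIIRep => (0 : ℂ)) ∈ QIIIRep.toFun.range := Subalgebra.zero_mem _
  rintro _ (rfl | rfl | rfl | rfl)
  · refine QIIIRep.det_mem_range (M := fun V => !![V.1 0 0, V.1 0 1, 0, 0;
      V.1 1 0, V.1 1 1, 0, 0;
      0, 0, V.2.2.2.2.1 0, V.2.2.2.2.1 1;
      0, 0, V.2.2.2.2.2 0, V.2.2.2.2.2 1]) fun i j => ?_
    fin_cases i <;> fin_cases j <;> first | exact hz | apply hA | apply hD1 | apply hD2
  · refine QIIIRep.det_mem_range (M := fun V => !![0, 0, V.2.1 0 0, V.2.1 0 1;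
      0, 0, V.2.1 1 0, V.2.1 1 1;
      V.2.2.1 0, V.2.2.1 1, 0, 0;
      V.2.2.2.1 0, V.2.2.2.1 1, 0, 0]) fun i j => ?_
    fin_cases i <;> fin_cases j <;> first | exact hz | apply hB | apply hC1 | apply hC2
  · refine QIIIRep.det_mem_range (M := fun V => !![V.1 0 0, V.1 0 1, V.2.1 0 0, V.2.1 0 1;
      V.1 1 0, V.1 1 1, V.2.1 1 0, V.2.1 1 1;
      V.2.2.1 0, V.2.2.1 1, 0, 0;
      0, 0, V.2.2.2.2.2 0, V.2.2.2.2.2 1]) fun i j => ?_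
    fin_cases i <;> fin_cases j <;> first | exact hz | apply hA | apply hB | apply hC1 | apply hD2
  · refine QIIIRep.det_mem_range (M := fun V => !![V.1 0 0, V.1 0 1, V.2.1 0 0, V.2.1 0 1;
      V.1 1 0, V.1 1 1, V.2.1 1 0, V.2.1 1 1;
      0, 0, V.2.2.2.2.1 0, V.2.2.2.2.1 1;
      V.2.2.2.1 0, V.2.2.2.1 1, 0, 0]) fun i j => ?_
    fin_cases i <;> fin_cases j <;> first | exact hz | apply hA | apply hB | apply hD1 | apply hC2

open Matrix in
/-- The polynomial function whose non-vanishing places a representation in general position. -/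
noncomputable def QIIIRep.genericity : QIIIRep → ℂ := fun V =>
  V.1.det * V.2.1.det *
    (Matrix.of ![V.2.2.2.1 ᵥ* V.1.adjugate, V.2.2.2.2.2 ᵥ* V.2.1.adjugate]).det

theorem QIIIRep.genericity_mem_range : QIIIRep.genericity ∈ QIIIRep.toFun.range := by
  have hA (k l) := QIIIRep.coord_mem_range (.inl (k, l))
  have hB (k l) := QIIIRep.coord_mem_range (.inr (.inl (k, l)))
  have hC2 (i) := QIIIRep.coord_mem_range (.inr (.inr (.inr (.inl i))))
  have hD2 (i) := QIIIRep.coord_mem_range (.inr (.inr (.inr (.inr (.inr i)))))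
  refine mul_mem (mul_mem (QIIIRep.det_mem_range hA) (QIIIRep.det_mem_range hB))
    (QIIIRep.det_mem_range fun i j => ?_)
  fin_cases i
  exacts [QIIIRep.vecMul_adjugate_mem_range hC2 hA j, QIIIRep.vecMul_adjugate_mem_range hD2 hB j]

theorem QIIIRep.genericity_ne_zero : QIIIRep.genericity ≠ 0 := by
  intro h
  have := congrFun h (1, 1, 0, ![1, 0], 0, ![0, 1])
  simp [QIIIRep.genericity, Matrix.det_fin_two] at this

/-- Every semi-invariant polynomial function on the representation space of `Q_III` at
dimension vector `(2,2;2,1,1)` (of weight `χ_θ^d` for some `d`) lies in the `ℂ`-subalgebra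
generated by `T₁, T₂, T₃, T₄`: the ring of semi-invariants is `ℂ[T₁,T₂,T₃,T₄]`. -/
theorem QIII_semiinvariants_generated_by_T
    (f : QIIIRep → ℂ)
    (hpoly : ∃ P : MvPolynomial
        ((Fin 2 × Fin 2) ⊕ (Fin 2 × Fin 2) ⊕ Fin 2 ⊕ Fin 2 ⊕ Fin 2 ⊕ Fin 2) ℂ,
      ∀ V : QIIIRep, f V = MvPolynomial.eval
        (Sum.elim (fun kl => V.1 kl.1 kl.2)
          (Sum.elim (fun kl => V.2.1 kl.1 kl.2)
            (Sum.elim V.2.2.1 (Sum.elim V.2.2.2.1 (Sum.elim V.2.2.2.2.1 V.2.2.2.2.2))))) P)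
    (d : ℕ)
    (hsemi : ∀ (g1 g2 h : GL (Fin 2) ℂ) (ν1 ν2 : ℂˣ)
      (A B : Matrix (Fin 2) (Fin 2) ℂ) (C1 C2 D1 D2 : Fin 2 → ℂ),
      f ((↑h : Matrix (Fin 2) (Fin 2) ℂ) * A * (↑(g1⁻¹) : Matrix (Fin 2) (Fin 2) ℂ),
         (↑h : Matrix (Fin 2) (Fin 2) ℂ) * B * (↑(g2⁻¹) : Matrix (Fin 2) (Fin 2) ℂ),
         (ν1 : ℂ) • Matrix.vecMul C1 (↑(g1⁻¹) : Matrix (Fin 2) (Fin 2) ℂ),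
         (ν2 : ℂ) • Matrix.vecMul C2 (↑(g1⁻¹) : Matrix (Fin 2) (Fin 2) ℂ),
         (ν1 : ℂ) • Matrix.vecMul D1 (↑(g2⁻¹) : Matrix (Fin 2) (Fin 2) ℂ),
         (ν2 : ℂ) • Matrix.vecMul D2 (↑(g2⁻¹) : Matrix (Fin 2) (Fin 2) ℂ))
        = ((((↑g1 : Matrix (Fin 2) (Fin 2) ℂ).det *
              (↑g2 : Matrix (Fin 2) (Fin 2) ℂ).det)⁻¹ *
            (↑h : Matrix (Fin 2) (Fin 2) ℂ).det * (ν1 : ℂ) * (ν2 : ℂ)) ^ d)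
            * f (A, B, C1, C2, D1, D2)) :
    f ∈ Algebra.adjoin ℂ ({QIIIT1, QIIIT2, QIIIT3, QIIIT4} : Set (QIIIRep → ℂ)) := by
  obtain ⟨P, hP⟩ := hpoly
  let n : QIIIRep → QIIIRep := fun V =>
    (1, 1, ![-QIIIT3 V, -QIIIT2 V], ![1, 0], ![QIIIT1 V, QIIIT4 V], ![0, 1])
  have hfP : f = QIIIRep.toFun P := by
    ext V
    rw [hP, QIIIRep.toFun, MvPolynomial.aeval_pi_apply]
    rfl
  let S := Algebra.adjoin ℂ ({QIIIT1, QIIIT2, QIIIT3, QIIIT4} : Set (QIIIRep → ℂ))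
  have hfn : (fun V => f (n V)) ∈ S := by
    have hn : (fun V => f (n V)) = MvPolynomial.aeval (fun i V => (n V).coords i) P := by
      ext V
      rw [hP, MvPolynomial.aeval_pi_apply]
      rfl
    have hT1 : QIIIT1 ∈ S := Algebra.subset_adjoin (by simp)
    have hT2 : QIIIT2 ∈ S := Algebra.subset_adjoin (by simp)
    have hT3 : QIIIT3 ∈ S := Algebra.subset_adjoin (by simp)
    have hT4 : QIIIT4 ∈ S := Algebra.subset_adjoin (by simp)
    rw [hn]
    have hrange := AlgHom.mem_range_self
      (MvPolynomial.aeval (R := ℂ) fun (i : QIIIRep.Coord) V => (n V).coords i) P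
    rw [MvPolynomial.aeval_range] at hrange
    refine Algebra.adjoin_le ?_ hrange
    rintro _ ⟨i, rfl⟩
    rcases i with ⟨k, l⟩ | ⟨k, l⟩ | i | i | i | i
    · exact S.algebraMap_mem ((1 : Matrix (Fin 2) (Fin 2) ℂ) k l)
    · exact S.algebraMap_mem ((1 : Matrix (Fin 2) (Fin 2) ℂ) k l)
    · fin_cases i
      exacts [S.neg_mem hT3, S.neg_mem hT2]
    · exact S.algebraMap_mem ((![1, 0] : Fin 2 → ℂ) i)
    · fin_cases i
      exacts [hT1, hT4]
    · exact S.algebraMap_mem ((![0, 1] : Fin 2 → ℂ) i)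
  obtain ⟨Q, hQ⟩ := Algebra.adjoin_le QIIIRep.T_mem_range hfn
  obtain ⟨R, hR⟩ := QIIIRep.genericity_mem_range
  have hprod : (P - Q) * R = 0 := by
    refine QIIIRep.toFun_injective ?_
    rw [map_zero, map_mul, map_sub, ← hfP]
    erw [hQ, hR]
    ext ⟨A, B, C1, C2, D1, D2⟩
    by_cases hV : QIIIRep.genericity (A, B, C1, C2, D1, D2) = 0
    · simp [hV]
    · obtain ⟨hAB, hE⟩ := mul_ne_zero_iff.1 hV
      obtain ⟨hA, hB⟩ := mul_ne_zero_iff.1 hAB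
      have := QIIIRep.semiinvariant_eq_normalForm f d hsemi A B C1 C2 D1 D2 hA hB hE
      simp [n, ← this]
  have hR0 : R ≠ 0 := by
    rintro rfl
    exact QIIIRep.genericity_ne_zero (hR.symm.trans (map_zero _))
  have hPQ : P = Q := sub_eq_zero.1 ((mul_eq_zero.1 hprod).resolve_right hR0)
  rw [hfP, hPQ]
  exact (show QIIIRep.toFun Q = fun V => f (n V) from hQ) ▸ hfn
end

section
/- Consider triples (A_1, A_2, A_3) ∈ Mat_2(ℂ)^3 and define six polynomial functions c_{rs} (1 ≤ r ≤ s ≤ 3) by the identity det(x_1 A_1 + x_2 A_2 + x_3 A_3) = Σ_{r≤s} c_{rs}(A_1,A_2,A_3) x_r x_s of polynomials in x_1, x_2, x_3. Then (i) the six functions c_{rs} are algebraically independent over ℂ, and (ii) every polynomial function f on Mat_2(ℂ)^3 such that for some d ∈ ℕ and all g, h ∈ GL_2(ℂ): f(g A_1 h, g A_2 h, g A_3 h) = (det g · det h)^d f(A_1,A_2,A_3), belongs to the ℂ-subalgebra generated by the c_{rs}. Hence the ring of semi-invariants of the quiver with two vertices and three arrows from the first to the second vertex, at dimension vector (2,2)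 and θ = (−1,1), is a polynomial ring in 6 variables, and the corresponding moduli space of θ-semistable representations is ℙ^5 (Barth, Hulek). -/
open MvPolynomial

/-- Index pairs `r ≤ s` of the coefficients of a ternary quadratic form. -/
abbrev QuadIdx : Type := {rs : Fin 3 × Fin 3 // rs.1 ≤ rs.2}

/-- Representations of the 3-arrow Kronecker quiver of dimension vector `(2,2)`. -/
abbrev MatTriple : Type := Fin 3 → Matrix (Fin 2) (Fin 2) ℂ

/-- The polarization of the determinant of `2 × 2` matrices. -/
def polarDet (B C : Matrix (Fin 2) (Fin 2) ℂ) : ℂ :=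
  B 0 0 * C 1 1 + C 0 0 * B 1 1 - B 0 1 * C 1 0 - C 0 1 * B 1 0

/-- The coefficients of the quadratic form `x ↦ det (∑ r, x r • A r)`. -/
def detCoeff (A : MatTriple) (rs : QuadIdx) : ℂ :=
  if rs.1.1 = rs.1.2 then (A rs.1.1).det else polarDet (A rs.1.1) (A rs.1.2)

theorem coeff_eq_detCoeff (c : Fin 3 → Fin 3 → MatTriple → ℂ)
    (hc : ∀ (A : MatTriple) (x : Fin 3 → ℂ), Matrix.det (∑ r, x r • A r) =
      ∑ r, ∑ s, if r ≤ s then c r s A * x r * x s else 0)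
    (A : MatTriple) (rs : QuadIdx) : c rs.1.1 rs.1.2 A = detCoeff A rs := by
  have h0 := hc A ![1, 0, 0]
  have h1 := hc A ![0, 1, 0]
  have h2 := hc A ![0, 0, 1]
  have h01 := hc A ![1, 1, 0]
  have h02 := hc A ![1, 0, 1]
  have h12 := hc A ![0, 1, 1]
  simp [Fin.sum_univ_three, Matrix.det_fin_two] at h0 h1 h2 h01 h02 h12
  obtain ⟨⟨r, s⟩, hrs⟩ := rs
  fin_cases r <;> fin_cases s <;> first
    | (exfalso; revert hrs; decide)
    | (simp [detCoeff, polarDet, Matrix.det_fin_two]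
       first
        | linear_combination -h0
        | linear_combination -h1
        | linear_combination -h2
        | linear_combination -h01 + h0 + h1
        | linear_combination -h02 + h0 + h2
        | linear_combination -h12 + h1 + h2)

/-- Every binary quadratic form over `ℂ` is a product of two linear forms. -/
theorem exists_binary_factorization (α β γ : ℂ) :
    ∃ s q u v : ℂ, s * u = α ∧ q * v = γ ∧ s * v + q * u = β := by
  by_cases hα : α = 0
  · exact ⟨0, 1, β, γ, by simp [hα], by simp, by simp⟩
  · obtain ⟨w, hw⟩ := IsAlgClosed.exists_eq_mul_self (discrim α (-β) γ)
    obtain ⟨q, hq⟩ := exists_quadratic_eq_zero hα ⟨w, hw⟩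
    exact ⟨1, q, α, β - α * q, by ring, by linear_combination -hq, by ring⟩

theorem detCoeff_surjective : Function.Surjective detCoeff := by
  intro z
  obtain ⟨s, q, u, v, h1, h2, h3⟩ := exists_binary_factorization
    (z ⟨(1, 1), le_rfl⟩) (z ⟨(1, 2), by decide⟩) (z ⟨(2, 2), le_rfl⟩)
  refine ⟨![!![1, 0; 0, z ⟨(0, 0), le_rfl⟩], !![0, s; -u, z ⟨(0, 1), by decide⟩],
    !![0, q; -v, z ⟨(0, 2), by decide⟩]], ?_⟩
  ext ⟨⟨r, t⟩, hrt⟩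
  fin_cases r <;> fin_cases t <;> first
    | (exfalso; revert hrt; decide)
    | (simp [detCoeff, polarDet, Matrix.det_fin_two]
       try first
        | linear_combination h1
        | linear_combination h2
        | linear_combination h3)

/-- The algebra of polynomial functions on triples of `2 × 2` matrices. -/
noncomputable def polyFun : Subalgebra ℂ (MatTriple → ℂ) :=
  (aeval (R := ℂ) fun (v : Fin 3 × Fin 2 × Fin 2) (A : MatTriple) => A v.1 v.2.1 v.2.2).range

theorem aeval_fun_apply {σ X : Type*} (φ : σ → X → ℂ) (P : MvPolynomial σ ℂ) (x : X) :
    aeval φ P x = eval (fun i => φ i x) P := by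
  induction P using MvPolynomial.induction_on with
  | C a => simp
  | add p q hp hq => simp [hp, hq]
  | mul_X p i hp => simp [hp]

theorem mem_polyFun {f : MatTriple → ℂ} : f ∈ polyFun ↔
    ∃ P : MvPolynomial (Fin 3 × Fin 2 × Fin 2) ℂ,
      ∀ A, f A = eval (fun v => A v.1 v.2.1 v.2.2) P := by
  constructor
  · rintro ⟨P, rfl⟩
    exact ⟨P, fun A => aeval_fun_apply _ _ _⟩
  · rintro ⟨P, hP⟩
    refine ⟨P, _root_.funext fun A => ?_⟩
    rw [hP]
    exact aeval_fun_apply _ _ _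

theorem entry_mem_polyFun (r : Fin 3) (i j : Fin 2) :
    (fun A : MatTriple => A r i j) ∈ polyFun :=
  mem_polyFun.2 ⟨X (r, i, j), by simp⟩

theorem eq_zero_of_mul_eq_zero_of_mem_polyFun {f g : MatTriple → ℂ} (hf : f ∈ polyFun)
    (hg : g ∈ polyFun) (hfg : f * g = 0) (hne : f ≠ 0) : g = 0 := by
  obtain ⟨P, hP⟩ := mem_polyFun.1 hf
  obtain ⟨Q, hQ⟩ := mem_polyFun.1 hg
  have hPQ : P * Q = 0 := by
    refine MvPolynomial.funext fun x => ?_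
    have := congrFun hfg fun r => Matrix.of fun i j => x (r, i, j)
    simpa [hP, hQ] using this
  rcases mul_eq_zero.1 hPQ with h | h
  · exact absurd (_root_.funext fun A => by simp [hP, h]) hne
  · exact _root_.funext fun A => by simp [hQ, h]

theorem detCoeff_mem_polyFun (rs : QuadIdx) : (fun A => detCoeff A rs) ∈ polyFun := by
  have h := entry_mem_polyFun
  unfold detCoeff
  split_ifs
  · simp only [Matrix.det_fin_two]
    exact sub_mem (mul_mem (h _ _ _) (h _ _ _)) (mul_mem (h _ _ _) (h _ _ _))
  · simp only [polarDet]
    exact sub_mem (sub_mem (add_mem (mul_mem (h _ _ _) (h _ _ _))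
      (mul_mem (h _ _ _) (h _ _ _))) (mul_mem (h _ _ _) (h _ _ _)))
      (mul_mem (h _ _ _) (h _ _ _))

theorem eval_detCoeff_mem_polyFun (G : MvPolynomial QuadIdx ℂ) :
    (fun A => eval (detCoeff A) G) ∈ polyFun := by
  induction G using MvPolynomial.induction_on with
  | C a => simp only [eval_C]; exact polyFun.algebraMap_mem a
  | add p q hp hq => simp only [map_add]; exact add_mem hp hq
  | mul_X p i hp => simp only [map_mul, eval_X]; exact mul_mem hp (detCoeff_mem_polyFun i)

theorem MvPolynomial.X_dvd_of_eval_eq_zero {σ : Type*} [DecidableEq σ] (i : σ)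
    (G : MvPolynomial σ ℂ) (hG : ∀ z : σ → ℂ, z i = 0 → eval z G = 0) : X i ∣ G := by
  have hzero : aeval (Function.update (X : σ → MvPolynomial σ ℂ) i 0) G = 0 := by
    refine MvPolynomial.funext fun z => ?_
    rw [map_zero, ← hG (Function.update z i 0) (by simp), ← aeval_eq_eval, ← aeval_eq_eval,
      ← AlgHom.comp_apply]
    congr 1
    ext j
    by_cases hj : j = i
    · subst hj; simp
    · simp [hj]
  have hmod : Ideal.Quotient.mkₐ ℂ (Ideal.span {(X i : MvPolynomial σ ℂ)}) =
      (Ideal.Quotient.mkₐ ℂ (Ideal.span {(X i : MvPolynomial σ ℂ)})).comp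
        (aeval (Function.update (X : σ → MvPolynomial σ ℂ) i 0)) := by
    ext j
    by_cases hj : j = i
    · subst hj
      simp
    · simp [hj]
  have := DFunLike.congr_fun hmod G
  rw [AlgHom.comp_apply, hzero, map_zero] at this
  exact Ideal.mem_span_singleton.1 (Ideal.Quotient.eq_zero_iff_mem.1 this)

theorem detCoeff_ne_zero (i : QuadIdx) : (fun A => detCoeff A i) ≠ 0 := by
  intro h
  obtain ⟨A, hA⟩ := detCoeff_surjective 1
  simpa [hA] using congrFun h A

/-- A coefficient can be cancelled from an equation between `f` and a polynomial in the
coefficients. -/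
theorem exists_eval_detCoeff_of_pow_mul (i : QuadIdx) {f : MatTriple → ℂ} (hf : f ∈ polyFun)
    (d : ℕ) (G : MvPolynomial QuadIdx ℂ)
    (h : ∀ A, detCoeff A i ^ d * f A = eval (detCoeff A) G) :
    ∃ G' : MvPolynomial QuadIdx ℂ, ∀ A, f A = eval (detCoeff A) G' := by
  induction d generalizing G with
  | zero => exact ⟨G, by simpa using h⟩
  | succ d ih =>
    obtain ⟨G', rfl⟩ : X i ∣ G := by
      refine MvPolynomial.X_dvd_of_eval_eq_zero i G fun z hz => ?_
      obtain ⟨A, rfl⟩ := detCoeff_surjective z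
      rw [← h A, hz]
      simp
    refine ih G' fun A => sub_eq_zero.1 (congrFun (eq_zero_of_mul_eq_zero_of_mem_polyFun
      (detCoeff_mem_polyFun i) (g := fun A => detCoeff A i ^ d * f A - eval (detCoeff A) G')
      (sub_mem (mul_mem (pow_mem (detCoeff_mem_polyFun i) d) hf)
        (eval_detCoeff_mem_polyFun G')) (_root_.funext fun A => ?_) (detCoeff_ne_zero i)) A)
    have := h A
    simp only [map_mul, eval_X] at this
    simp only [Pi.mul_apply, Pi.zero_apply]
    linear_combination this

/-- A pair of `2 × 2` matrices without common eigenvector is conjugate to a normal form which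
depends only on its trace invariants and the choice of an eigenvalue of the first matrix. -/
theorem exists_conj_normalForm (B C : Matrix (Fin 2) (Fin 2) ℂ) (ρ : ℂ)
    (hρ : ρ ^ 2 - B.trace * ρ + B.det = 0) (hBC : (B * C - C * B).det ≠ 0) :
    ∃ P : GL (Fin 2) ℂ,
      B * (P : Matrix (Fin 2) (Fin 2) ℂ) =
        P * !![ρ, ρ * C.trace - polarDet B C; 0, B.trace - ρ] ∧
      C * (P : Matrix (Fin 2) (Fin 2) ℂ) = P * !![0, -C.det; 1, C.trace] := by
  obtain ⟨v, hv, hBv⟩ : ∃ v : Fin 2 → ℂ, v ≠ 0 ∧ (B - ρ • 1).mulVec v = 0 := by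
    rw [Matrix.exists_mulVec_eq_zero_iff]
    simp [Matrix.det_fin_two, Matrix.trace_fin_two] at hρ ⊢
    linear_combination hρ
  have e0 := congrFun hBv 0
  have e1 := congrFun hBv 1
  simp [Matrix.mulVec, dotProduct, Fin.sum_univ_two] at e0 e1
  set M : Matrix (Fin 2) (Fin 2) ℂ :=
    !![v 0, C 0 0 * v 0 + C 0 1 * v 1; v 1, C 1 0 * v 0 + C 1 1 * v 1] with hM
  have hdet : M.det ≠ 0 := by
    intro h0
    simp [hM, Matrix.det_fin_two] at h0
    have key : ∀ i j, v i * (B * C - C * B).mulVec v j = 0 := by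
      simp only [Fin.forall_fin_two, Matrix.mulVec, dotProduct, Fin.sum_univ_two,
        Matrix.sub_apply, Matrix.mul_apply]
      refine ⟨⟨?_, ?_⟩, ?_, ?_⟩
      · linear_combination (C 0 0 * v 0 + C 0 1 * v 1) * e0 + B 0 1 * h0 -
          v 0 * (C 0 0 * e0 + C 0 1 * e1)
      · linear_combination (C 0 0 * v 0 + C 0 1 * v 1) * e1 + (B 1 1 - ρ) * h0 -
          v 0 * (C 1 0 * e0 + C 1 1 * e1)
      · linear_combination (C 1 0 * v 0 + C 1 1 * v 1) * e0 - (B 0 0 - ρ) * h0 -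
          v 1 * (C 0 0 * e0 + C 0 1 * e1)
      · linear_combination (C 1 0 * v 0 + C 1 1 * v 1) * e1 - B 1 0 * h0 -
          v 1 * (C 1 0 * e0 + C 1 1 * e1)
    apply hBC
    rw [← Matrix.exists_mulVec_eq_zero_iff]
    refine ⟨v, hv, ?_⟩
    by_contra hne
    obtain ⟨j, hj⟩ := Function.ne_iff.1 hne
    exact hv (_root_.funext fun i => (mul_eq_zero.1 (key i j)).resolve_right hj)
  refine ⟨Matrix.GeneralLinearGroup.mkOfDetNeZero M hdet, ?_, ?_⟩
  · change B * M = M * _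
    ext i j
    fin_cases i <;> fin_cases j <;>
      simp [hM, Matrix.mul_apply, Fin.sum_univ_two, Matrix.trace_fin_two B,
        Matrix.trace_fin_two C, polarDet]
    · linear_combination e0
    · linear_combination (C 0 0 + C 1 1) * e0 - (C 0 0 * e0 + C 0 1 * e1)
    · linear_combination e1
    · linear_combination (C 0 0 + C 1 1) * e1 - (C 1 0 * e0 + C 1 1 * e1)
  · change C * M = M * _
    ext i j
    fin_cases i <;> fin_cases j <;>
      simp [hM, Matrix.mul_apply, Fin.sum_univ_two, Matrix.trace_fin_two, Matrix.det_fin_two] <;>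
      ring

/-- The normal form of a triple with prescribed coefficients `z`, for a root `ρ` of
`ρ² - z₀₁ ρ + z₀₀ z₁₁`. -/
def normalTriple (z : QuadIdx → ℂ) (ρ : ℂ) : MatTriple :=
  ![!![z ⟨(0, 0), le_rfl⟩, 0; 0, z ⟨(0, 0), le_rfl⟩],
    !![ρ, ρ * z ⟨(0, 2), by decide⟩ - z ⟨(0, 0), le_rfl⟩ * z ⟨(1, 2), by decide⟩;
      0, z ⟨(0, 1), by decide⟩ - ρ],
    !![0, -(z ⟨(0, 0), le_rfl⟩ * z ⟨(2, 2), le_rfl⟩); 1, z ⟨(0, 2), by decide⟩]]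

theorem exists_linear_in_root (P : MvPolynomial (Fin 3 × Fin 2 × Fin 2) ℂ) :
    ∃ G₀ G₁ : MvPolynomial QuadIdx ℂ, ∀ (z : QuadIdx → ℂ) (ρ : ℂ),
      ρ ^ 2 - z ⟨(0, 1), by decide⟩ * ρ + z ⟨(0, 0), le_rfl⟩ * z ⟨(1, 1), le_rfl⟩ = 0 →
      eval (fun v => normalTriple z ρ v.1 v.2.1 v.2.2) P = eval z G₀ + ρ * eval z G₁ := by
  induction P using MvPolynomial.induction_on with
  | C a => exact ⟨C a, 0, by simp⟩
  | add p q hp hq =>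
    obtain ⟨G₀, G₁, hG⟩ := hp
    obtain ⟨H₀, H₁, hH⟩ := hq
    refine ⟨G₀ + H₀, G₁ + H₁, fun z ρ h => ?_⟩
    simp only [map_add, hG z ρ h, hH z ρ h]
    ring
  | mul_X p i hp =>
    obtain ⟨G₀, G₁, hG⟩ := hp
    obtain ⟨H₀, H₁, hH⟩ : ∃ H₀ H₁ : MvPolynomial QuadIdx ℂ, ∀ (z : QuadIdx → ℂ) (ρ : ℂ),
        normalTriple z ρ i.1 i.2.1 i.2.2 = eval z H₀ + ρ * eval z H₁ := by
      obtain ⟨r, i, j⟩ := i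
      fin_cases r <;> fin_cases i <;> fin_cases j <;> simp [normalTriple]
      · exact ⟨X ⟨(0, 0), le_rfl⟩, 0, by simp⟩
      · exact ⟨0, 0, by simp⟩
      · exact ⟨0, 0, by simp⟩
      · exact ⟨X ⟨(0, 0), le_rfl⟩, 0, by simp⟩
      · exact ⟨0, 1, by simp⟩
      · exact ⟨-(X ⟨(0, 0), le_rfl⟩ * X ⟨(1, 2), by decide⟩), X ⟨(0, 2), by decide⟩,
          fun z ρ => by simp; ring⟩
      · exact ⟨0, 0, by simp⟩
      · exact ⟨X ⟨(0, 1), by decide⟩, -1, fun z ρ => by simp; ring⟩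
      · exact ⟨0, 0, by simp⟩
      · exact ⟨-(X ⟨(0, 0), le_rfl⟩ * X ⟨(2, 2), le_rfl⟩), 0, by simp⟩
      · exact ⟨1, 0, by simp⟩
      · exact ⟨X ⟨(0, 2), by decide⟩, 0, by simp⟩
    refine ⟨G₀ * H₀ - X ⟨(0, 0), le_rfl⟩ * X ⟨(1, 1), le_rfl⟩ * G₁ * H₁,
      G₀ * H₁ + G₁ * H₀ + X ⟨(0, 1), by decide⟩ * G₁ * H₁, fun z ρ h => ?_⟩
    simp only [map_mul, map_add, map_sub, eval_X, hG z ρ h, hH z ρ]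
    linear_combination (eval z G₁ * eval z H₁) * h

/-- The discriminant whose nonvanishing guarantees that a triple can be put in normal form. -/
def genericDisc (A : MatTriple) : ℂ :=
  (A 0).det * ((A 0).adjugate * A 1 * ((A 0).adjugate * A 2) -
    (A 0).adjugate * A 2 * ((A 0).adjugate * A 1)).det

theorem genericDisc_mem_polyFun : genericDisc ∈ polyFun := by
  have h := entry_mem_polyFun
  have hmul {M N : MatTriple → Matrix (Fin 2) (Fin 2) ℂ}
      (hM : ∀ i j, (fun A => M A i j) ∈ polyFun)
      (hN : ∀ i j, (fun A => N A i j) ∈ polyFun) (i j : Fin 2) :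
      (fun A => (M A * N A) i j) ∈ polyFun := by
    simp only [Matrix.mul_apply, Fin.sum_univ_two]
    exact add_mem (mul_mem (hM _ _) (hN _ _)) (mul_mem (hM _ _) (hN _ _))
  have hdet {M : MatTriple → Matrix (Fin 2) (Fin 2) ℂ}
      (hM : ∀ i j, (fun A => M A i j) ∈ polyFun) : (fun A => (M A).det) ∈ polyFun := by
    simp only [Matrix.det_fin_two]
    exact sub_mem (mul_mem (hM _ _) (hM _ _)) (mul_mem (hM _ _) (hM _ _))
  have hadj (i j : Fin 2) : (fun A : MatTriple => (A 0).adjugate i j) ∈ polyFun := by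
    simp only [Matrix.adjugate_fin_two]
    fin_cases i <;> fin_cases j
    · exact h 0 1 1
    · exact neg_mem (h 0 0 1)
    · exact neg_mem (h 0 1 0)
    · exact h 0 0 0
  exact mul_mem (hdet (h 0)) (hdet fun i j => sub_mem
    (hmul (hmul hadj (h 1)) (hmul hadj (h 2)) i j) (hmul (hmul hadj (h 2)) (hmul hadj (h 1)) i j))

theorem genericDisc_ne_zero : genericDisc ≠ 0 := by
  intro h
  have := congrFun h ![1, !![0, 1; 0, 0], !![0, 0; 1, 0]]
  simp [genericDisc, Matrix.det_fin_two] at this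

/-- A semi-invariant of weight `d` is determined on generic triples by its values on normal
forms. -/
theorem semiinvariant_eq_normalTriple {f : MatTriple → ℂ} {d : ℕ}
    (hf : ∀ (g h : GL (Fin 2) ℂ) (A : MatTriple),
      f (fun r => (↑g : Matrix (Fin 2) (Fin 2) ℂ) * A r * (↑h : Matrix (Fin 2) (Fin 2) ℂ)) =
        ((↑g : Matrix (Fin 2) (Fin 2) ℂ).det * (↑h : Matrix (Fin 2) (Fin 2) ℂ).det) ^ d * f A)
    (A : MatTriple) (hA : genericDisc A ≠ 0) (ρ : ℂ)
    (hρ : ρ ^ 2 - detCoeff A ⟨(0, 1), by decide⟩ * ρ +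
      detCoeff A ⟨(0, 0), le_rfl⟩ * detCoeff A ⟨(1, 1), le_rfl⟩ = 0) :
    detCoeff A ⟨(0, 0), le_rfl⟩ ^ d * f A = f (normalTriple (detCoeff A) ρ) := by
  obtain ⟨hdet, hcomm⟩ := mul_ne_zero_iff.1 hA
  set Q := (A 0).adjugate with hQ
  have hQdet : Q.det = (A 0).det := by
    simp [hQ, Matrix.adjugate_fin_two, Matrix.det_fin_two]; ring
  have t1 : (Q * A 1).trace = detCoeff A ⟨(0, 1), by decide⟩ := by
    rw [Matrix.trace_fin_two, Matrix.mul_apply, Matrix.mul_apply]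
    simp [hQ, detCoeff, polarDet, Matrix.adjugate_fin_two]; ring
  have t2 : (Q * A 2).trace = detCoeff A ⟨(0, 2), by decide⟩ := by
    rw [Matrix.trace_fin_two, Matrix.mul_apply, Matrix.mul_apply]
    simp [hQ, detCoeff, polarDet, Matrix.adjugate_fin_two]; ring
  have d1 : (Q * A 1).det = detCoeff A ⟨(0, 0), le_rfl⟩ * detCoeff A ⟨(1, 1), le_rfl⟩ := by
    rw [Matrix.det_mul, hQdet]; simp [detCoeff]
  have d2 : (Q * A 2).det = detCoeff A ⟨(0, 0), le_rfl⟩ * detCoeff A ⟨(2, 2), le_rfl⟩ := by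
    rw [Matrix.det_mul, hQdet]; simp [detCoeff]
  have p12 : polarDet (Q * A 1) (Q * A 2) =
      detCoeff A ⟨(0, 0), le_rfl⟩ * detCoeff A ⟨(1, 2), by decide⟩ := by
    simp [hQ, detCoeff, polarDet, Matrix.adjugate_fin_two, Matrix.det_fin_two,
      Matrix.mul_apply, Fin.sum_univ_two]; ring
  obtain ⟨P, hB, hC⟩ := exists_conj_normalForm (Q * A 1) (Q * A 2) ρ
    (by rw [t1, d1]; exact hρ) hcomm
  have hP : ((P⁻¹ : GL (Fin 2) ℂ) : Matrix (Fin 2) (Fin 2) ℂ) *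
      (P : Matrix (Fin 2) (Fin 2) ℂ) = 1 := by
    rw [← Units.val_mul, inv_mul_cancel, Units.val_one]
  have hPdet : ((P⁻¹ : GL (Fin 2) ℂ) : Matrix (Fin 2) (Fin 2) ℂ).det *
      (P : Matrix (Fin 2) (Fin 2) ℂ).det = 1 := by
    rw [← Matrix.det_mul, hP, Matrix.det_one]
  set g : GL (Fin 2) ℂ := P⁻¹ * Matrix.GeneralLinearGroup.mkOfDetNeZero Q (hQdet ▸ hdet)
  have hgval : (g : Matrix (Fin 2) (Fin 2) ℂ) = (P⁻¹ : GL (Fin 2) ℂ) * Q := rfl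
  have := hf g P A
  rw [hgval, Matrix.det_mul, mul_right_comm, hPdet, one_mul, hQdet] at this
  rw [show detCoeff A ⟨(0, 0), le_rfl⟩ = (A 0).det by simp [detCoeff], ← this]
  congr 1
  ext1 r
  rw [Matrix.mul_assoc _ Q, Matrix.mul_assoc]
  fin_cases r
  · change _ * (Q * A 0 * _) = !![_, _; _, _]
    rw [hQ, Matrix.adjugate_mul, Matrix.smul_mul, Matrix.one_mul, Matrix.mul_smul, hP]
    ext i j
    fin_cases i <;> fin_cases j <;> simp [detCoeff]
  · change _ * (Q * A 1 * _) = !![_, _; _, _]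
    rw [hB, ← Matrix.mul_assoc, hP, Matrix.one_mul, t1, t2, p12]
  · change _ * (Q * A 2 * _) = !![_, _; _, _]
    rw [hC, ← Matrix.mul_assoc, hP, Matrix.one_mul, t2, d2]

theorem semiinvariant_eq_eval_detCoeff {f : MatTriple → ℂ} (hpoly : f ∈ polyFun) {d : ℕ}
    (hf : ∀ (g h : GL (Fin 2) ℂ) (A : MatTriple),
      f (fun r => (↑g : Matrix (Fin 2) (Fin 2) ℂ) * A r * (↑h : Matrix (Fin 2) (Fin 2) ℂ)) =
        ((↑g : Matrix (Fin 2) (Fin 2) ℂ).det * (↑h : Matrix (Fin 2) (Fin 2) ℂ).det) ^ d * f A) :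
    ∃ G : MvPolynomial QuadIdx ℂ, ∀ A, f A = eval (detCoeff A) G := by
  obtain ⟨P, hP⟩ := mem_polyFun.1 hpoly
  obtain ⟨G₀, G₁, hG⟩ := exists_linear_in_root P
  -- Averaging over the two roots `ρ` and `z₀₁ - ρ`.
  set G : MvPolynomial QuadIdx ℂ := G₀ + C (1 / 2) * X ⟨(0, 1), by decide⟩ * G₁ with hGdef
  have hgen : ∀ A, genericDisc A ≠ 0 →
      detCoeff A ⟨(0, 0), le_rfl⟩ ^ d * f A = eval (detCoeff A) G := by
    intro A hA
    obtain ⟨w, hw⟩ := IsAlgClosed.exists_eq_mul_self (discrim 1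
      (-detCoeff A ⟨(0, 1), by decide⟩)
      (detCoeff A ⟨(0, 0), le_rfl⟩ * detCoeff A ⟨(1, 1), le_rfl⟩))
    obtain ⟨ρ, hρ⟩ := exists_quadratic_eq_zero one_ne_zero ⟨w, hw⟩
    have key : ∀ ρ : ℂ, ρ ^ 2 - detCoeff A ⟨(0, 1), by decide⟩ * ρ +
        detCoeff A ⟨(0, 0), le_rfl⟩ * detCoeff A ⟨(1, 1), le_rfl⟩ = 0 →
        detCoeff A ⟨(0, 0), le_rfl⟩ ^ d * f A =
          eval (detCoeff A) G₀ + ρ * eval (detCoeff A) G₁ := fun ρ h => by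
      rw [semiinvariant_eq_normalTriple hf A hA ρ h, hP, hG _ _ h]
    have k1 := key ρ (by linear_combination hρ)
    have k2 := key (detCoeff A ⟨(0, 1), by decide⟩ - ρ) (by linear_combination hρ)
    simp only [hGdef, map_add, map_mul, eval_C, eval_X]
    linear_combination (1 / 2) * k1 + (1 / 2) * k2
  refine exists_eval_detCoeff_of_pow_mul ⟨(0, 0), le_rfl⟩ hpoly d G fun A => sub_eq_zero.1
    (congrFun (eq_zero_of_mul_eq_zero_of_mem_polyFun genericDisc_mem_polyFun
      (g := fun A => detCoeff A ⟨(0, 0), le_rfl⟩ ^ d * f A - eval (detCoeff A) G)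
      (sub_mem (mul_mem (pow_mem (detCoeff_mem_polyFun _) d) hpoly)
        (eval_detCoeff_mem_polyFun G)) (_root_.funext fun A => ?_) genericDisc_ne_zero) A)
  by_cases hA : genericDisc A = 0
  · simp [hA]
  · simp [hgen A hA]

/-- For the 3-arrow Kronecker quiver at dimension vector `(2,2)` and `θ = (−1,1)`:
the six coefficient functions `c_{rs}` (`r ≤ s`) of `det(x₁A₁ + x₂A₂ + x₃A₃)` are
algebraically independent over `ℂ`, and every semi-invariant polynomial function lies in
the `ℂ`-subalgebra they generate; hence the ring of semi-invariants is a polynomial ring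
in `6` variables and the moduli space is `ℙ⁵` (Barth, Hulek). -/
theorem kronecker_three_arrows_semiinvariants
    (c : Fin 3 → Fin 3 → ((Fin 3 → Matrix (Fin 2) (Fin 2) ℂ) → ℂ))
    (hc : ∀ (A : Fin 3 → Matrix (Fin 2) (Fin 2) ℂ) (x : Fin 3 → ℂ),
      Matrix.det (∑ r, x r • A r) =
        ∑ r, ∑ s, if r ≤ s then c r s A * x r * x s else 0) :
    AlgebraicIndependent ℂ
      (fun rs : {rs : Fin 3 × Fin 3 // rs.1 ≤ rs.2} => c rs.1.1 rs.1.2) ∧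
    ∀ f : (Fin 3 → Matrix (Fin 2) (Fin 2) ℂ) → ℂ,
      (∃ P : MvPolynomial (Fin 3 × Fin 2 × Fin 2) ℂ,
        ∀ A, f A = MvPolynomial.eval (fun v => A v.1 v.2.1 v.2.2) P) →
      (∃ d : ℕ, ∀ (g h : GL (Fin 2) ℂ) (A : Fin 3 → Matrix (Fin 2) (Fin 2) ℂ),
        f (fun r => (↑g : Matrix (Fin 2) (Fin 2) ℂ) * A r * (↑h : Matrix (Fin 2) (Fin 2) ℂ))
          = ((↑g : Matrix (Fin 2) (Fin 2) ℂ).det * (↑h : Matrix (Fin 2) (Fin 2) ℂ).det) ^ d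
              * f A) →
      f ∈ Algebra.adjoin ℂ
        (Set.range (fun rs : {rs : Fin 3 × Fin 3 // rs.1 ≤ rs.2} => c rs.1.1 rs.1.2)) := by
  have hcA : ∀ A, (fun rs : QuadIdx => c rs.1.1 rs.1.2 A) = detCoeff A :=
    fun A => _root_.funext (coeff_eq_detCoeff c hc A)
  refine ⟨?_, ?_⟩
  · rw [algebraicIndependent_iff]
    intro p hp
    refine MvPolynomial.funext fun z => ?_
    obtain ⟨A, rfl⟩ := detCoeff_surjective z
    have := congrFun hp A
    rw [aeval_fun_apply, hcA] at this
    simpa using this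
  · rintro f hpoly ⟨d, hf⟩
    obtain ⟨G, hG⟩ := semiinvariant_eq_eval_detCoeff (mem_polyFun.2 hpoly) hf
    rw [Algebra.adjoin_range_eq_range_aeval]
    refine ⟨G, _root_.funext fun A => ?_⟩
    rw [hG, ← hcA]
    exact aeval_fun_apply _ _ _
end

section
/- Let p, q ≥ 2 be coprime integers and let G = ⟨x, y | x^p = y^q⟩ be the (p,q)-torus knot group, i.e. the presented group on two generators x, y with the single relator x^p y^{-q}. Then the center of G is the cyclic subgroup generated by the image of x^p. -/
namespace Monoid.CoprodI

variable {ι : Type*}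

/-- Reduced words with the same product have the same first index. -/
theorem NeWord.fst_eq_of_prod_eq {M : ι → Type*} [∀ i, Monoid (M i)] {i j k l : ι}
    {u : NeWord M i j} {v : NeWord M k l} (h : u.prod = v.prod) : i = k := by
  classical
  have hw : u.toWord = v.toWord := (Word.equiv (M := M)).symm.injective h
  have hl : u.toList = v.toList := congrArg Word.toList hw
  have hh := u.toList_head?
  rw [hl, v.toList_head?] at hh
  exact (congrArg Sigma.fst (Option.some.inj hh)).symm

/-- The free product of at least two nontrivial groups has trivial center. -/
theorem center_eq_bot [Nontrivial ι] (G : ι → Type*) [∀ i, Group (G i)]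
    [∀ i, Nontrivial (G i)] : Subgroup.center (CoprodI G) = ⊥ := by
  classical
  rw [eq_bot_iff]
  intro z hz
  rw [Subgroup.mem_center_iff] at hz
  obtain ⟨w, rfl⟩ := (Word.equiv (M := G)).symm.surjective z
  change ∀ g, g * w.prod = w.prod * g at hz
  change w.prod = 1
  induction w using Word.consRecOn with
  | empty => exact Word.prod_empty
  | cons i m w hw hm _ =>
    exfalso
    rw [Word.prod_cons] at hz
    obtain ⟨k, hk⟩ := exists_ne i
    obtain ⟨a, ha⟩ := exists_ne (1 : G k)
    by_cases hwe : w = Word.empty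
    · subst hwe
      refine hk (NeWord.fst_eq_of_prod_eq (M := G)
        (u := .append (.singleton a ha) hk (.singleton m hm))
        (v := .append (.singleton m hm) hk.symm (.singleton a ha)) ?_)
      simpa using hz (of a)
    · obtain ⟨s, j, w, rfl⟩ := NeWord.of_word w hwe
      have hs : s ≠ i := by
        rintro rfl
        simp [Word.fstIdx, NeWord.toWord] at hw
      change ∀ g, g * (of m * w.prod) = of m * w.prod * g at hz
      by_cases hj : j = i
      · subst hj
        refine hk (NeWord.fst_eq_of_prod_eq (M := G)
          (u := .append (.singleton a ha) hk (.append (.singleton m hm) hs.symm w))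
          (v := .append (.append (.singleton m hm) hs.symm w) hk.symm (.singleton a ha)) ?_)
        simpa using hz (of a)
      · refine hs (NeWord.fst_eq_of_prod_eq (M := G)
          (u := .append w hj (.singleton m hm))
          (v := .append (.singleton m hm) hs.symm w) ?_)
        have := hz (of m)
        rw [mul_assoc, mul_right_inj] at this
        simpa using this.symm

end Monoid.CoprodI

/-- An element whose `n`-th power is trivial is the image of the generator of the cyclic group
of order `n`. -/
theorem exists_monoidHom_zmod_of_pow_eq_one {K : Type*} [Group K] {n : ℕ} {g : K}
    (hg : g ^ n = 1) :
    ∃ f : Multiplicative (ZMod n) →* K, f (Multiplicative.ofAdd 1) = g := by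
  let e : ℤ →+ Additive K := zmultiplesHom (Additive K) (Additive.ofMul g)
  have he : e n = 0 := by
    simp only [e, zmultiplesHom_apply, natCast_zsmul]
    exact hg
  refine ⟨AddMonoidHom.toMultiplicativeLeft (ZMod.lift n ⟨e, he⟩), ?_⟩
  have h1 : ZMod.lift n ⟨e, he⟩ ((1 : ℤ) : ZMod n) = Additive.ofMul g := by
    rw [ZMod.lift_coe]
    simp [e]
  rw [Int.cast_one] at h1
  exact h1

/-- If `x 0` and `x 1` generate `G` and `x 0 ^ n 0 = x 1 ^ n 1` is central, then the kernel of a map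
to the free product of `ℤ/n 0` and `ℤ/n 1` matching the generators lies in `⟨x 0 ^ n 0⟩`. -/
theorem mem_zpowers_of_map_eq_one {G : Type*} [Group G] {x : Fin 2 → G} {n : Fin 2 → ℕ}
    (hx : Subgroup.closure (Set.range x) = ⊤) (h : x 0 ^ n 0 = x 1 ^ n 1)
    (hc : x 0 ^ n 0 ∈ Subgroup.center G)
    {φ : G →* Monoid.CoprodI fun i => Multiplicative (ZMod (n i))}
    (hφ : ∀ i, φ (x i) = Monoid.CoprodI.of (M := fun i => Multiplicative (ZMod (n i)))
      (Multiplicative.ofAdd (1 : ZMod (n i))))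
    {g : G} (hg : φ g = 1) : g ∈ Subgroup.zpowers (x 0 ^ n 0) := by
  have : (Subgroup.zpowers (x 0 ^ n 0)).Normal :=
    ⟨fun a ha b => by
      rwa [Subgroup.mem_center_iff.1 (Subgroup.zpowers_le.2 hc ha) b, mul_inv_cancel_right]⟩
  have hpow (i : Fin 2) : (QuotientGroup.mk' (Subgroup.zpowers (x 0 ^ n 0)) (x i)) ^ n i = 1 := by
    rw [← map_pow]
    refine (QuotientGroup.eq_one_iff _).2 ?_
    fin_cases i
    · exact Subgroup.mem_zpowers _
    · exact h ▸ Subgroup.mem_zpowers (x 0 ^ n 0)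
  choose f hf using fun i => exists_monoidHom_zmod_of_pow_eq_one (hpow i)
  have hcomp : (Monoid.CoprodI.lift f).comp φ = QuotientGroup.mk' _ := by
    refine MonoidHom.eq_of_eqOn_dense hx ?_
    rintro _ ⟨i, rfl⟩
    simp [hφ, hf]
  have := DFunLike.congr_fun hcomp g
  rw [MonoidHom.comp_apply, hg, map_one] at this
  exact (QuotientGroup.eq_one_iff g).1 this.symm

/-- The center of the `(p,q)`-torus knot group `⟨x, y ∣ x^p = y^q⟩` is the cyclic
subgroup generated by (the image of) `x^p`. -/
theorem center_of_torus_knot_group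
    (p q : ℕ) (hp : 2 ≤ p) (hq : 2 ≤ q) (hpq : Nat.Coprime p q) :
    Subgroup.center
        (PresentedGroup
          ({FreeGroup.of (0 : Fin 2) ^ p * (FreeGroup.of (1 : Fin 2) ^ q)⁻¹} :
            Set (FreeGroup (Fin 2))))
      = Subgroup.zpowers
          ((PresentedGroup.of (0 : Fin 2) :
            PresentedGroup
              ({FreeGroup.of (0 : Fin 2) ^ p * (FreeGroup.of (1 : Fin 2) ^ q)⁻¹} :
                Set (FreeGroup (Fin 2)))) ^ p) := by
  set r : Set (FreeGroup (Fin 2)) :=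
    {FreeGroup.of (0 : Fin 2) ^ p * (FreeGroup.of (1 : Fin 2) ^ q)⁻¹}
  let x : Fin 2 → PresentedGroup r := PresentedGroup.of
  let n : Fin 2 → ℕ := ![p, q]
  have hgen : Subgroup.closure (Set.range x) = ⊤ := PresentedGroup.closure_range_of r
  have hrel : x 0 ^ p = x 1 ^ q := by
    have := PresentedGroup.mk_eq_mk_of_mul_inv_mem (rels := r)
      (x := FreeGroup.of 0 ^ p) (y := FreeGroup.of 1 ^ q) rfl
    rwa [map_pow, map_pow] at this
  have hc : x 0 ^ p ∈ Subgroup.center (PresentedGroup r) := by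
    refine Subgroup.mem_center_iff.2 fun g => Subgroup.mem_centralizer_singleton_iff.1
      (PresentedGroup.generated_by r (Subgroup.centralizer {x 0 ^ p}) (fun i => ?_) g)
    rw [Subgroup.mem_centralizer_singleton_iff]
    fin_cases i
    · exact (pow_mul_comm' (x 0) p).symm
    · rw [hrel]
      exact (pow_mul_comm' (x 1) q).symm
  refine le_antisymm (fun z hz => ?_) (Subgroup.zpowers_le.2 hc)
  have (i : Fin 2) : Fact (1 < n i) := ⟨by fin_cases i <;> simpa [n]⟩
  let y (i : Fin 2) : Monoid.CoprodI fun i => Multiplicative (ZMod (n i)) :=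
    Monoid.CoprodI.of (M := fun i => Multiplicative (ZMod (n i)))
      (Multiplicative.ofAdd (1 : ZMod (n i)))
  have hy (i : Fin 2) : y i ^ n i = 1 := by
    simp [y, ← map_pow, ← ofAdd_nsmul]
  have hlift : ∀ s ∈ r, FreeGroup.lift y s = 1 := by
    rintro s rfl
    have h0 : y 0 ^ p = 1 := hy 0
    have h1 : y 1 ^ q = 1 := hy 1
    simp [h0, h1]
  let φ := PresentedGroup.toGroup hlift
  have hφ (i : Fin 2) : φ (x i) = y i := PresentedGroup.toGroup.of hlift
  have hsurj : Function.Surjective φ := by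
    intro w
    induction w using Monoid.CoprodI.induction_on with
    | one => exact ⟨1, map_one φ⟩
    | of i m =>
      refine ⟨x i ^ (Multiplicative.toAdd m).val, ?_⟩
      rw [map_pow, hφ, ← map_pow, ← ofAdd_nsmul, nsmul_one, ZMod.natCast_zmod_val, ofAdd_toAdd]
    | mul a b ha hb =>
      obtain ⟨a, rfl⟩ := ha
      obtain ⟨b, rfl⟩ := hb
      exact ⟨a * b, map_mul φ a b⟩
  have hφz : φ z ∈ Subgroup.center (Monoid.CoprodI fun i => Multiplicative (ZMod (n i))) := by
    refine Subgroup.mem_center_iff.2 fun w => ?_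
    obtain ⟨g, rfl⟩ := hsurj w
    rw [← map_mul, Subgroup.mem_center_iff.1 hz, map_mul]
  rw [Monoid.CoprodI.center_eq_bot, Subgroup.mem_bot] at hφz
  exact mem_zpowers_of_map_eq_one hgen hrel hc hφ hφz
end
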